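/- arXiv:math/0303386 — 2 statements merged into one kernel-verified Lean document; each statement's English description precedes it below -/
import Mathlib

section
/- The set SM of strictly minimal cyclically reduced words is exponentially generic in the set C of all cyclically reduced words, and the set SM' is exponentially generic in F_k. -/
/-! Common definitions: free group `FG k = F(a_1,…,a_k)`, reduced and cyclically
reduced words, Whitehead automorphisms, strict minimality, counting functions and
exponential genericity, following Kapovich–Schupp–Shpilrain. -/

/-- The free group of rank `k` on the basis `a_1,…,a_k`. -/
abbrev FG (k : ℕ) := FreeGroup (Fin k)

/-- The alphabet `Σ = {a_1,…,a_k}^{±1}`: a letter is a basis index together with a sign. -/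
abbrev Letter (k : ℕ) := Fin k × Bool

/-- The inverse of a letter. -/
def linv {k : ℕ} (x : Letter k) : Letter k := (x.1, !x.2)

/-- The length `|g|` of the reduced word representing `g`. -/
def wordLength {k : ℕ} (g : FG k) : ℕ := (FreeGroup.toWord g).length

/-- A word is (freely) reduced if it equals its free reduction. -/
def ReducedWord {k : ℕ} (w : List (Letter k)) : Prop := FreeGroup.reduce w = w

/-- A word is cyclically reduced if all of its cyclic permutations are reduced;
equivalently, `w ++ w` is reduced. -/
def CyclicallyReducedWord {k : ℕ} (w : List (Letter k)) : Prop :=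
  FreeGroup.reduce (w ++ w) = w ++ w

/-- An element of `FG k` is cyclically reduced if its reduced word is. -/
def IsCyclicallyReduced {k : ℕ} (g : FG k) : Prop :=
  CyclicallyReducedWord (FreeGroup.toWord g)

/-- `C`, the set of all cyclically reduced elements of `FG k`. -/
def Cset (k : ℕ) : Set (FG k) := {g | IsCyclicallyReduced g}

/-- The cyclic length `‖g‖`: the length of the cyclically reduced form of `g`
(the unique cyclically reduced `u` with `g = x u x⁻¹`). -/
noncomputable def cyclicLength {k : ℕ} (g : FG k) : ℕ :=
  sInf {n | ∃ x u : FG k, IsCyclicallyReduced u ∧ g = x * u * x⁻¹ ∧ wordLength u = n}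

/-- The set `Σ = {a_1,…,a_k}^{±1}` inside the free group. -/
def letterSet (k : ℕ) : Set (FG k) :=
  {g | ∃ i : Fin k, g = FreeGroup.of i ∨ g = (FreeGroup.of i)⁻¹}

/-- A Whitehead automorphism of the first kind: a relabeling automorphism,
i.e. one whose restriction to `Σ` is a permutation of `Σ`. -/
def IsRelabeling {k : ℕ} (τ : MulAut (FG k)) : Prop :=
  (⇑τ) '' letterSet k = letterSet k

/-- A Whitehead automorphism of the second kind, with multiplier `a ∈ Σ`:
`τ a = a` and `τ x ∈ {x, xa, a⁻¹x, a⁻¹xa}` for all `x ∈ Σ`. -/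
def IsWhitehead2 {k : ℕ} (τ : MulAut (FG k)) : Prop :=
  ∃ a ∈ letterSet k, τ a = a ∧
    ∀ x ∈ letterSet k, τ x = x ∨ τ x = x * a ∨ τ x = a⁻¹ * x ∨ τ x = a⁻¹ * x * a

/-- An automorphism is inner if it is conjugation by some element. -/
def IsInner {k : ℕ} (α : MulAut (FG k)) : Prop := ∃ g : FG k, α = MulAut.conj g

/-- `SM`: the set of strictly minimal cyclically reduced elements, those `w` with
`‖τ w‖ > |w|` for every non-inner Whitehead automorphism `τ` of the second kind. -/
def SM (k : ℕ) : Set (FG k) :=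
  {w | IsCyclicallyReduced w ∧
    ∀ τ : MulAut (FG k), IsWhitehead2 τ → ¬ IsInner τ → wordLength w < cyclicLength (τ w)}

/-- `SM'`: elements whose cyclically reduced form lies in `SM`. -/
def SM' (k : ℕ) : Set (FG k) := {g | ∃ x u : FG k, u ∈ SM k ∧ g = x * u * x⁻¹}

/-- `γ(n,S)`: the number of elements of `S` of length `n`. -/
noncomputable def gammaC {k : ℕ} (S : Set (FG k)) (n : ℕ) : ℕ :=
  {g ∈ S | wordLength g = n}.ncard

/-- `ρ(n,S)`: the number of elements of `S` of length at most `n`. -/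
noncomputable def rhoC {k : ℕ} (S : Set (FG k)) (n : ℕ) : ℕ :=
  {g ∈ S | wordLength g ≤ n}.ncard

/-- `B ⊆ S` is exponentially generic in `S` if `ρ(n,B)/ρ(n,S) → 1`
exponentially fast. -/
def ExpGenericIn {k : ℕ} (B S : Set (FG k)) : Prop :=
  B ⊆ S ∧ ∃ K : ℝ, 0 < K ∧ ∃ σ : ℝ, 0 < σ ∧ σ < 1 ∧
    ∀ n : ℕ, |1 - (rhoC B n : ℝ) / (rhoC S n : ℝ)| ≤ K * σ ^ n

/-- `B` is exponentially negligible in `S` if `S \ B` is exponentially generic in `S`. -/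
def ExpNegligibleIn {k : ℕ} (B S : Set (FG k)) : Prop := ExpGenericIn (S \ B) S

/-- The orbit `Aut(F_k) w`. -/
def autOrbit {k : ℕ} (w : FG k) : Set (FG k) := {g | ∃ α : MulAut (FG k), α w = g}

/-- `u` is a cyclic permutation of `v`: the reduced word of `u` is a rotation of
the reduced word of `v`. -/
def IsCyclicPerm {k : ℕ} (u v : FG k) : Prop :=
  ∃ n : ℕ, FreeGroup.toWord u = (FreeGroup.toWord v).rotate n

/-- `w` is a proper power: `w = uⁿ` for some `n ≥ 2`. -/
def IsProperPower {k : ℕ} (w : FG k) : Prop := ∃ (u : FG k) (n : ℕ), 2 ≤ n ∧ w = u ^ n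

/-- `TS`: strictly minimal cyclically reduced `w` which are not proper powers and
are not conjugate to `τ w` for any nontrivial relabeling automorphism `τ`. -/
def TS (k : ℕ) : Set (FG k) :=
  {w | w ∈ SM k ∧ ¬ IsProperPower w ∧
    ∀ τ : MulAut (FG k), IsRelabeling τ → τ ≠ 1 → ¬ IsConj (τ w) w}

/-- `TS'`: elements whose cyclically reduced form lies in `TS`. -/
def TS' (k : ℕ) : Set (FG k) := {g | ∃ x u : FG k, u ∈ TS k ∧ g = x * u * x⁻¹}

/-- `Z`: elements of `TS` such that no relabeling automorphism sends `w` to a cyclic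
permutation of `w⁻¹`. -/
def Zset (k : ℕ) : Set (FG k) :=
  {w | w ∈ TS k ∧ ¬ ∃ τ : MulAut (FG k), IsRelabeling τ ∧ IsCyclicPerm (τ w) w⁻¹}

/-- Growth entropy `H(S) = limsup ρ(n,S)^{1/n}`. -/
noncomputable def entropyH {k : ℕ} (S : Set (FG k)) : ℝ :=
  Filter.limsup (fun n : ℕ => (rhoC S n : ℝ) ^ ((n : ℝ)⁻¹)) Filter.atTop

/-- Number of occurrences of the two-letter word `xy` as a subword of `w`. -/
def countPair {k : ℕ} (w : List (Letter k)) (x y : Letter k) : ℕ :=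
  (w.zip w.tail).count (x, y)

/-- The label `ŵ_{xy}` of the edge `[x⁻¹, y]` in the weighted Whitehead graph of the
cyclically reduced word `w`: occurrences of `xy` and of `y⁻¹x⁻¹` in `wc`, where `c` is
the first letter of `w`. -/
def whLabel {k : ℕ} (w : List (Letter k)) (x y : Letter k) : ℕ :=
  countPair (w ++ w.take 1) x y + countPair (w ++ w.take 1) (linv y) (linv x)

/-- The one-relator group `G_u = ⟨a_1,…,a_k ∣ u = 1⟩`. -/
abbrev OneRel (k : ℕ) (u : FG k) := FG k ⧸ Subgroup.normalClosure ({u} : Set (FG k))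

/-- `u` is primitive: it belongs to some free basis of `FG k`, equivalently it is the
image of a basis element under an automorphism. -/
def IsPrimitive {k : ℕ} (u : FG k) : Prop :=
  ∃ (α : MulAut (FG k)) (i : Fin k), α (FreeGroup.of i) = u


namespace WH

theorem linv_linv {k : ℕ} (x : Letter k) : linv (linv x) = x := by
  simp [linv]

theorem linv_fst {k : ℕ} (x : Letter k) : (linv x).1 = x.1 := rfl

theorem eq_or_linv {k : ℕ} {x y : Letter k} (h : x.1 = y.1) : x = y ∨ x = linv y := by
  obtain ⟨x1, x2⟩ := x
  obtain ⟨y1, y2⟩ := y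
  simp only at h
  subst h
  cases x2 <;> cases y2 <;> simp [linv]

theorem rel_iff {k : ℕ} (x y : Letter k) : (x.1 = y.1 → x.2 = y.2) ↔ y ≠ linv x := by
  obtain ⟨x1, x2⟩ := x
  obtain ⟨y1, y2⟩ := y
  simp only [linv, ne_eq, Prod.mk.injEq, not_and]
  constructor
  · rintro h rfl; cases x2 <;> cases y2 <;> simp_all
  · rintro h rfl; cases x2 <;> cases y2 <;> simp_all

def mw {k : ℕ} (α x : Letter k) : List (Letter k) := if x.1 = α.1 then [] else [x]

def ap {k : ℕ} (α : Letter k) : Bool → Bool → List (Letter k)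
  | true, false => [α]
  | false, true => [linv α]
  | _, _ => []

def ow {k : ℕ} (α : Letter k) (R : Letter k → Bool) : Letter k → List (Letter k) → List (Letter k)
  | x, [] => mw α x ++ ap α (R x) false
  | x, y :: v => mw α x ++ (ap α (R x) (R (linv y)) ++ ow α R y v)

def fw {k : ℕ} (α : Letter k) (R : Letter k → Bool) (x y : Letter k) : ℤ :=
  (if R x = R (linv y) then 0 else 1) - (if y.1 = α.1 then 1 else 0)

/-- path sum -/
def ps {k : ℕ} (f : Letter k → Letter k → ℤ) : Letter k → List (Letter k) → ℤ
  | _, [] => 0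
  | x, y :: v => f x y + ps f y v

theorem ow_length {k : ℕ} (α : Letter k) (R : Letter k → Bool) (v : List (Letter k)) :
    ∀ x, ((mw α x).length : ℤ) + v.length + ps (fw α R) x v ≤ (ow α R x v).length := by
  induction v with
  | nil => intro x; simp [ow, ps]
  | cons y v ih =>
    intro x
    have := ih y
    simp only [ow, ps, fw, List.length_append, List.length_cons, mw] at *
    cases h1 : R x <;> cases h2 : R (linv y) <;> by_cases h : y.1 = α.1 <;>
      simp_all [ap] <;> linarith

theorem isReduced_cons_iff {k : ℕ} (x : Letter k) (v : List (Letter k)) :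
    FreeGroup.IsReduced (x :: v) ↔ (∀ y ∈ v.head?, y ≠ linv x) ∧ FreeGroup.IsReduced v := by
  cases v with
  | nil => simp
  | cons y v => simp [FreeGroup.IsReduced, rel_iff]

theorem ow_reduced {k : ℕ} (α : Letter k) (R : Letter k → Bool) (h1 : R α = true)
    (h2 : R (linv α) = false) (v : List (Letter k)) :
    ∀ x, FreeGroup.IsReduced (x :: v) → FreeGroup.IsReduced (ow α R x v) ∧
      ∀ e ∈ (ow α R x v).head?, e = x ∨ (e.1 ≠ α.1 ∧ x.1 = α.1 ∧ R (linv e) ≠ R (linv x)) := by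
  have hne : α ≠ linv α := by intro h; rw [← h, h1] at h2; cases h2
  induction v with
  | nil =>
    intro x hx
    by_cases h : x.1 = α.1
    · rcases eq_or_linv h with rfl | rfl 
      · simp [ow, mw, h1, ap]
      · simp [ow, mw, h2, ap, linv_fst]
    · cases hR : R x <;> simp [ow, mw, ap, h, hR]
  | cons y v ih =>
    intro x hx
    rw [isReduced_cons_iff] at hx
    obtain ⟨hxy, hyv⟩ := hx
    have hxy : y ≠ linv x := hxy y (by simp)
    obtain ⟨ih1, ih2⟩ := ih y hyv
    have key : FreeGroup.IsReduced (ap α (R x) (R (linv y)) ++ ow α R y v) := by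
      cases hx : R x <;> cases hy : R (linv y)
      · simpa [ap] using ih1
      · simp only [ap, List.cons_append, List.nil_append, isReduced_cons_iff, linv_linv]
        refine ⟨?_, ih1⟩
        rintro e he rfl
        rcases ih2 _ he with rfl | ⟨h, _⟩
        · rw [h2] at hy; cases hy
        · exact h rfl
      · simp only [ap, List.cons_append, List.nil_append, isReduced_cons_iff]
        refine ⟨?_, ih1⟩
        rintro e he rfl
        rcases ih2 _ he with rfl | ⟨h, _⟩
        · rw [linv_linv, h1] at hy; cases hy
        · exact h rfl
      · simpa [ap] using ih1
    by_cases h : x.1 = α.1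
    · simp only [ow, mw, h, if_true, List.nil_append]
      refine ⟨key, ?_⟩
      rcases eq_or_linv h with rfl | rfl
      · cases hy : R (linv y)
        · simp [ap, h1]
        · simp only [h1, ap, List.nil_append]
          intro e he
          rcases ih2 e he with rfl | ⟨h3, h4, h5⟩
          · right
            refine ⟨?_, trivial, ?_⟩
            · intro h4
              rcases eq_or_linv h4 with rfl | rfl
              · rw [h2] at hy; cases hy
              · exact hxy rfl
            · rw [hy, h2]; simp
          · rcases eq_or_linv h4 with rfl | rfl
            · left; rw [h2] at hy; cases hy
            · exact absurd rfl hxy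
      · cases hy : R (linv y)
        · simp only [h2, ap, List.nil_append]
          intro e he
          rcases ih2 e he with rfl | ⟨h3, h4, h5⟩
          · right
            refine ⟨?_, trivial, ?_⟩
            · intro h4
              rcases eq_or_linv h4 with rfl | rfl
              · exact hxy (linv_linv _).symm
              · rw [linv_linv, h1] at hy; cases hy
            · rw [hy, linv_linv, h1]; simp
          · rcases eq_or_linv h4 with rfl | rfl
            · exact absurd (linv_linv _).symm hxy
            · rw [linv_linv, h1] at hy; cases hy
        · simp [ap, h2]
    · simp only [ow, mw, h, if_false, List.cons_append, List.nil_append]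
      refine ⟨?_, by simp⟩
      rw [isReduced_cons_iff]
      refine ⟨?_, key⟩
      cases hx : R x <;> cases hy : R (linv y) <;>
        simp only [ap, List.nil_append, List.cons_append, List.head?_cons, Option.mem_def, Option.some.injEq]
      · rintro e he rfl
        rcases ih2 _ he with rfl | ⟨h3, h4, h5⟩
        · exact hxy rfl
        · rw [linv_linv, hx, hy] at h5; exact h5 rfl
      · rintro e rfl h3
        exact h (by rw [← linv_fst x, ← h3, linv_fst])
      · rintro e rfl h3
        exact h (by rw [← linv_fst x, ← h3])
      · rintro e he rfl
        rcases ih2 _ he with rfl | ⟨h3, h4, h5⟩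
        · exact hxy rfl
        · rw [linv_linv, hx, hy] at h5; exact h5 rfl

theorem mk_linv {k : ℕ} (x : Letter k) : FreeGroup.mk [linv x] = (FreeGroup.mk [x])⁻¹ := by
  simp [linv, FreeGroup.invRev]

theorem ap_mul {k : ℕ} (α : Letter k) (r l : Bool) :
    FreeGroup.mk (ap α r false) * FreeGroup.mk (ap α false l) = FreeGroup.mk (ap α r l) := by
  cases r <;> cases l <;> simp only [ap, mk_linv, ← FreeGroup.one_eq_mk] <;> simp [-FreeGroup.inv_mk, -FreeGroup.mul_mk]

theorem tau_eq {k : ℕ} (τ : MulAut (FG k)) (α : Letter k) (R : Letter k → Bool)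
    (hτ : ∀ x, τ (FreeGroup.mk [x]) = FreeGroup.mk (ap α false (R (linv x))) *
      (FreeGroup.mk (mw α x) * FreeGroup.mk (ap α (R x) false))) (v : List (Letter k)) :
    ∀ x, τ (FreeGroup.mk (x :: v)) =
      FreeGroup.mk (ap α false (R (linv x))) * FreeGroup.mk (ow α R x v) := by
  induction v with
  | nil => intro x; rw [hτ, ow, ← FreeGroup.mul_mk]
  | cons y v ih =>
    intro x
    have : (FreeGroup.mk (x :: y :: v)) = FreeGroup.mk [x] * FreeGroup.mk (y :: v) := by
      rw [FreeGroup.mul_mk]; rfl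
    rw [this, map_mul, ih, hτ, ow, ← FreeGroup.mul_mk, ← FreeGroup.mul_mk, ← ap_mul α (R x) (R (linv y))]
    group

theorem ap_length {k : ℕ} (α : Letter k) (r l : Bool) : (ap α r l).length ≤ 1 := by
  cases r <;> cases l <;> simp [ap]

theorem tau_norm {k : ℕ} (τ : MulAut (FG k)) (α : Letter k) (R : Letter k → Bool)
    (h1 : R α = true) (h2 : R (linv α) = false)
    (hτ : ∀ x, τ (FreeGroup.mk [x]) = FreeGroup.mk (ap α false (R (linv x))) *
      (FreeGroup.mk (mw α x) * FreeGroup.mk (ap α (R x) false))) (v : List (Letter k))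
    (x : Letter k) (hv : FreeGroup.IsReduced (x :: v)) :
    (v.length : ℤ) + ps (fw α R) x v ≤ (τ (FreeGroup.mk (x :: v))).norm + 1 := by
  have a1 := ow_length α R v x
  have a2 := (ow_reduced α R h1 h2 v x hv).1
  have a3 : (FreeGroup.mk (ow α R x v)).norm = (ow α R x v).length := by
    rw [FreeGroup.norm, FreeGroup.toWord_mk, a2.reduce_eq]
  have a4 := tau_eq τ α R hτ v x
  have a5 : FreeGroup.mk (ow α R x v) =
      (FreeGroup.mk (ap α false (R (linv x))))⁻¹ * τ (FreeGroup.mk (x :: v)) := by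
    rw [a4]; group
  have a6 := FreeGroup.norm_mul_le (FreeGroup.mk (ap α false (R (linv x))))⁻¹ (τ (FreeGroup.mk (x :: v)))
  rw [← a5, a3, FreeGroup.norm_inv_eq] at a6
  have a7 := (FreeGroup.norm_mk_le (L₁ := ap α false (R (linv x)))).trans (ap_length _ _ _)
  zify at a6 a7
  have : (0 : ℤ) ≤ (mw α x).length := by positivity
  linarith


structure Adm {k : ℕ} (α : Letter k) (R : Letter k → Bool) : Prop where
  h1 : R α = true
  h2 : R (linv α) = false
  h3 : ∃ x, x ≠ α ∧ R x = true
  h4 : ∃ x, x ≠ linv α ∧ R x = false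

theorem mk_true {k : ℕ} (j : Fin k) : FreeGroup.mk [(j, true)] = FreeGroup.of j := rfl

theorem mk_false {k : ℕ} (j : Fin k) : FreeGroup.mk [(j, false)] = (FreeGroup.of j)⁻¹ := rfl

theorem ap_false_true {k : ℕ} (α : Letter k) :
    FreeGroup.mk (ap α false true) = (FreeGroup.mk [α])⁻¹ := mk_linv α

theorem ap_inv {k : ℕ} (α : Letter k) (r l : Bool) :
    (FreeGroup.mk (ap α r l))⁻¹ = FreeGroup.mk (ap α l r) := by
  cases r <;> cases l <;> simp only [ap, mk_linv, ← FreeGroup.one_eq_mk, inv_inv, inv_one]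

theorem whitehead_data {k : ℕ} (τ : MulAut (FG k)) (hw : IsWhitehead2 τ) (hi : ¬ IsInner τ) :
    ∃ α R, Adm α R ∧ ∀ x, τ (FreeGroup.mk [x]) = FreeGroup.mk (ap α false (R (linv x))) *
      (FreeGroup.mk (mw α x) * FreeGroup.mk (ap α (R x) false)) := by
  obtain ⟨a, ⟨i, ha⟩, hta, hx⟩ := hw
  obtain ⟨α, rfl⟩ : ∃ α : Letter k, a = FreeGroup.mk [α] := by
    rcases ha with h | h
    · exact ⟨(i, true), h⟩
    · exact ⟨(i, false), h⟩
  have e1 : ∀ j, ∃ L R : Bool, τ (FreeGroup.of j) = FreeGroup.mk (ap α false L) *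
      (FreeGroup.of j * FreeGroup.mk (ap α R false)) := by
    intro j
    rcases hx (FreeGroup.of j) ⟨j, Or.inl rfl⟩ with h | h | h | h
    · exact ⟨false, false, by simp [h, ap, ← FreeGroup.one_eq_mk]⟩
    · exact ⟨false, true, by rw [h]; simp only [ap, ← FreeGroup.one_eq_mk, one_mul]⟩
    · exact ⟨true, false, by rw [h, ap_false_true]; simp only [ap, ← FreeGroup.one_eq_mk, mul_one]⟩
    · exact ⟨true, true, by rw [h, ap_false_true]; simp only [ap, mul_assoc]⟩
  choose L R' hLR using e1
  let R : Letter k → Bool := fun x =>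
    if x = α then true else if x = linv α then false else if x.2 then R' x.1 else L x.1
  have hne : α ≠ linv α := by
    intro h; have := congrArg Prod.snd h; simp [linv] at this
  have h1 : R α = true := by simp [R]
  have h2 : R (linv α) = false := by simp [R, hne.symm]
  have hR : ∀ x : Letter k, x.1 ≠ α.1 → R x = if x.2 then R' x.1 else L x.1 := by
    intro x h
    have q1 : x ≠ α := by rintro rfl; exact h rfl
    have q2 : x ≠ linv α := by rintro rfl; exact h rfl
    simp only [R, q1, q2, if_false]
  have main : ∀ x, τ (FreeGroup.mk [x]) = FreeGroup.mk (ap α false (R (linv x))) *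
      (FreeGroup.mk (mw α x) * FreeGroup.mk (ap α (R x) false)) := by
    intro x
    by_cases h : x.1 = α.1
    · rcases eq_or_linv h with rfl | rfl
      · rw [hta, h1, h2]; simp only [ap, mw, if_true, ← FreeGroup.one_eq_mk, one_mul]
      · rw [linv_linv, mk_linv, map_inv, hta, h1, h2, ap_false_true]
        simp only [ap, mw, linv_fst, if_true, ← FreeGroup.one_eq_mk, one_mul, mul_one]
    · rw [hR x h, hR (linv x) h]
      obtain ⟨j, b⟩ := x
      simp only at h
      cases b
      · rw [mk_false, map_inv, hLR]
        simp only [mul_inv_rev, ap_inv, linv, mw, h, if_false, mk_false]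
        simp [mul_assoc, -FreeGroup.mul_mk]
      · rw [mk_true, hLR]
        simp only [linv, mw, h, if_false, mk_true]
        simp
  refine ⟨α, R, ⟨h1, h2, ?_, ?_⟩, main⟩
  · by_contra! hc
    apply hi
    refine ⟨1, ?_⟩
    have : τ.toMonoidHom = (MulAut.conj (1 : FG k)).toMonoidHom := by
      apply FreeGroup.ext_hom
      intro j
      have hm := main (j, true)
      have : ∀ x : Letter k, x ≠ α → R x = false := fun x h => by simpa using hc x h
      by_cases h : j = α.1
      · rcases eq_or_linv (x := (j, true)) (y := α) h with h' | h'
        · rw [← mk_true, h']; simp [hta]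
        · rw [← mk_true, h', mk_linv]; simp [-FreeGroup.inv_mk, hta]
      · rw [this (linv (j, true)) (by rintro h'; apply h; rw [← h']; rfl), this (j, true) (by rintro h'; apply h; rw [← h'])] at hm
        simpa [mw, h, ap, ← FreeGroup.one_eq_mk, mk_true] using hm
    exact MulEquiv.toMonoidHom_injective this
  · by_contra! hc
    apply hi
    refine ⟨(FreeGroup.mk [α])⁻¹, ?_⟩
    have : τ.toMonoidHom = (MulAut.conj (FreeGroup.mk [α] : FG k)⁻¹).toMonoidHom := by
      apply FreeGroup.ext_hom
      intro j
      have hm := main (j, true)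
      have : ∀ x : Letter k, x ≠ linv α → R x = true := fun x h => by simpa using hc x h
      by_cases h : j = α.1
      · rcases eq_or_linv (x := (j, true)) (y := α) h with h' | h'
        · rw [← mk_true, h']; simp [-FreeGroup.inv_mk, -FreeGroup.mul_mk, hta]
        · rw [← mk_true, h', mk_linv]; simp [-FreeGroup.inv_mk, -FreeGroup.mul_mk, hta]
      · rw [this (linv (j, true)) (by rintro h'; apply h; have := congrArg Prod.fst h'; exact this), this (j, true) (by rintro h'; apply h; have := congrArg Prod.fst h'; exact this), ap_false_true] at hm
        simpa [mw, h, ap, mk_true, -FreeGroup.inv_mk, -FreeGroup.mul_mk, mul_assoc] using hm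
    exact MulEquiv.toMonoidHom_injective this

theorem fw_ge {k : ℕ} (α : Letter k) (R : Letter k → Bool) (x y : Letter k) : -1 ≤ fw α R x y := by
  unfold fw; split_ifs <;> simp

theorem ps_append {k : ℕ} (f : Letter k → Letter k → ℤ) (hf : ∀ x y, -1 ≤ f x y)
    (v : List (Letter k)) (y : Letter k) (u : List (Letter k)) :
    ∀ x, ps f x v + ps f y u - 1 ≤ ps f x (v ++ y :: u) := by
  induction v with
  | nil => intro x; have := hf x y; simp only [ps, List.nil_append]; linarith
  | cons z v ih => intro x; have := ih z; simp only [ps, List.cons_append]; linarith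

def tp {k : ℕ} (x : Letter k) (v : List (Letter k)) : ℕ → List (Letter k)
  | 0 => v
  | m + 1 => v ++ x :: tp x v m

theorem tp_eq {k : ℕ} (x : Letter k) (v : List (Letter k)) (m : ℕ) :
    x :: tp x v m = (List.replicate (m + 1) (x :: v)).flatten := by
  induction m with
  | zero => simp [tp]
  | succ m ih => rw [List.replicate_succ, List.flatten_cons, ← ih]; simp [tp]

theorem tp_mk {k : ℕ} (x : Letter k) (v : List (Letter k)) (m : ℕ) :
    FreeGroup.mk (x :: tp x v m) = (FreeGroup.mk (x :: v)) ^ (m + 1) := by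
  induction m with
  | zero => simp [tp]
  | succ m ih => rw [pow_succ', ← ih, FreeGroup.mul_mk]; simp [tp]

theorem tp_length {k : ℕ} (x : Letter k) (v : List (Letter k)) (m : ℕ) :
    ((tp x v m).length : ℤ) = (m + 1) * (v.length + 1) - 1 := by
  induction m with
  | zero => simp [tp]
  | succ m ih => simp only [tp, List.length_append, List.length_cons]; push_cast; rw [ih]; ring

theorem tp_ps {k : ℕ} (f : Letter k → Letter k → ℤ) (hf : ∀ x y, -1 ≤ f x y)
    (x : Letter k) (v : List (Letter k)) (m : ℕ) :
    (m + 1) * ps f x v - m ≤ ps f x (tp x v m) := by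
  induction m with
  | zero => simp [tp]
  | succ m ih =>
    have := ps_append f hf v x (tp x v m) x
    simp only [tp]; push_cast; linarith

theorem norm_pow_le {k : ℕ} (u : FG k) (m : ℕ) : (u ^ m).norm ≤ m * u.norm := by
  induction m with
  | zero => simp
  | succ m ih =>
    rw [pow_succ]
    have := FreeGroup.norm_mul_le (u ^ m) u
    linarith

theorem cyc_iff {k : ℕ} (w : List (Letter k)) :
    CyclicallyReducedWord w ↔ FreeGroup.IsCyclicallyReduced w := by
  rw [CyclicallyReducedWord, ← FreeGroup.isReduced_iff_reduce_eq, FreeGroup.isCyclicallyReduced_iff,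
    FreeGroup.IsReduced, List.isChain_append]
  simp only [FreeGroup.IsReduced]
  tauto

theorem small_ps {k : ℕ} (τ : MulAut (FG k)) (α : Letter k) (R : Letter k → Bool)
    (h1 : R α = true) (h2 : R (linv α) = false)
    (hτ : ∀ x, τ (FreeGroup.mk [x]) = FreeGroup.mk (ap α false (R (linv x))) *
      (FreeGroup.mk (mw α x) * FreeGroup.mk (ap α (R x) false))) (v : List (Letter k))
    (x : Letter k) (hv : FreeGroup.IsCyclicallyReduced (x :: v)) (y u : FG k)
    (hu : τ (FreeGroup.mk (x :: v)) = y * u * y⁻¹) (hle : u.norm ≤ v.length + 1) :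
    ps (fw α R) x v ≤ 1 := by
  by_contra! hc
  let m := 2 * y.norm + 1
  have b1 : FreeGroup.IsReduced (x :: tp x v m) := by
    rw [tp_eq]; exact (hv.flatten_replicate _).1
  have b2 := tau_norm τ α R h1 h2 hτ _ x b1
  have b3 : τ (FreeGroup.mk (x :: tp x v m)) = y * u ^ (m + 1) * y⁻¹ := by
    rw [tp_mk, map_pow, hu, conj_pow]
  have b4 : (y * u ^ (m + 1) * y⁻¹).norm ≤ y.norm + (m + 1) * u.norm + y.norm := by
    have c1 := FreeGroup.norm_mul_le (y * u ^ (m + 1)) y⁻¹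
    have c2 := FreeGroup.norm_mul_le y (u ^ (m + 1))
    have c3 := norm_pow_le u (m + 1)
    rw [FreeGroup.norm_inv_eq] at c1
    linarith
  have b5 := tp_ps (fw α R) (fw_ge α R) x v m
  have b7 : (m + 1) * u.norm ≤ (m + 1) * (v.length + 1) := Nat.mul_le_mul_left _ hle
  rw [b3, tp_length] at b2
  zify at b4 b7
  have b8 : ((m : ℤ) + 1) * 2 ≤ (m + 1) * ps (fw α R) x v :=
    mul_le_mul_of_nonneg_left hc (by positivity)
  have b9 : (m : ℤ) = 2 * y.norm + 1 := by simp [m]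
  linarith

theorem exists_cyc {k : ℕ} (g : FG k) : ∃ x u : FG k, IsCyclicallyReduced u ∧ g = x * u * x⁻¹ ∧
    wordLength g = 2 * wordLength x + wordLength u := by
  have hg : FreeGroup.IsReduced g.toWord := FreeGroup.isReduced_toWord
  have h := FreeGroup.reduceCyclically.conj_conjugator_reduceCyclically g.toWord
  have hc := FreeGroup.reduceCyclically.isCyclicallyReduced hg
  set c := FreeGroup.reduceCyclically.conjugator g.toWord
  set r := FreeGroup.reduceCyclically g.toWord
  have hcr : FreeGroup.IsReduced c := hg.infix ⟨[], r ++ FreeGroup.invRev c, by rw [← h]; simp⟩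
  have e1 : (FreeGroup.mk c).toWord = c := by rw [FreeGroup.toWord_mk, hcr.reduce_eq]
  have e2 : (FreeGroup.mk r).toWord = r := by rw [FreeGroup.toWord_mk, hc.1.reduce_eq]
  refine ⟨FreeGroup.mk c, FreeGroup.mk r, ?_, ?_, ?_⟩
  · unfold IsCyclicallyReduced; rw [e2, cyc_iff]; exact hc
  · rw [FreeGroup.inv_mk, FreeGroup.mul_mk, FreeGroup.mul_mk, h, FreeGroup.mk_toWord]
  · unfold wordLength
    rw [e1, e2, ← h]; simp [FreeGroup.invRev_length]; ring

theorem bad_data {k : ℕ} (w : FG k) (hw : w ∈ Cset k) (hb : w ∉ SM k) (x : Letter k)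
    (v : List (Letter k)) (hwv : w.toWord = x :: v) :
    ∃ α R, Adm α R ∧ ps (fw α R) x v ≤ 1 := by
  have : ∃ τ : MulAut (FG k), IsWhitehead2 τ ∧ ¬ IsInner τ ∧ cyclicLength (τ w) ≤ wordLength w := by
    by_contra! hc
    exact hb ⟨hw, hc⟩
  obtain ⟨τ, ht, hi, hl⟩ := this
  obtain ⟨α, R, hA, hτ⟩ := whitehead_data τ ht hi
  refine ⟨α, R, hA, ?_⟩
  have hm : FreeGroup.mk (x :: v) = w := by rw [← hwv, FreeGroup.mk_toWord]
  have hcs : cyclicLength (τ w) ∈ {n | ∃ x u : FG k, IsCyclicallyReduced u ∧ τ w = x * u * x⁻¹ ∧ wordLength u = n} := by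
    apply Nat.sInf_mem
    obtain ⟨x, u, h1, h2, h3⟩ := exists_cyc (τ w)
    exact ⟨_, x, u, h1, h2, rfl⟩
  obtain ⟨y, u, h1, h2, h3⟩ := hcs
  refine small_ps τ α R hA.h1 hA.h2 hτ v x ?_ y u (by rw [hm, h2]) ?_
  · rw [← hwv]; exact (cyc_iff _).1 hw
  · have : wordLength w = v.length + 1 := by simp [wordLength, hwv]
    rw [← this]; rw [← h3] at hl; exact hl


def tw {k : ℕ} : ℕ → Letter k → Finset (List (Letter k))
  | 0, _ => {[]}
  | n + 1, x => (Finset.univ.filter (fun y => y ≠ linv x)).biUnion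
      fun y => (tw n y).image (fun v => y :: v)

theorem mem_tw {k : ℕ} (n : ℕ) : ∀ (x : Letter k) (v : List (Letter k)),
    v ∈ tw n x ↔ v.length = n ∧ FreeGroup.IsReduced (x :: v) := by
  induction n with
  | zero => intro x v; cases v <;> simp [tw]
  | succ n ih =>
    intro x v
    cases v with
    | nil => simp [tw]
    | cons y v =>
      simp only [tw, Finset.mem_biUnion, Finset.mem_filter, Finset.mem_univ, true_and,
        Finset.mem_image, isReduced_cons_iff x, List.length_cons]
      constructor
      · rintro ⟨z, hz, u, hu, he⟩
        simp only [List.cons.injEq] at he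
        obtain ⟨rfl, rfl⟩ := he
        rw [ih] at hu
        exact ⟨by omega, by simpa using hz, hu.2⟩
      · rintro ⟨h1, h2, h3⟩
        exact ⟨y, h2 y (by simp), v, (ih _ _).2 ⟨by omega, h3⟩, rfl⟩

theorem sum_tw {k : ℕ} (n : ℕ) (x : Letter k) (g : List (Letter k) → ℝ) :
    ∑ v ∈ tw (n + 1) x, g v =
      ∑ y ∈ Finset.univ.filter (fun y => y ≠ linv x), ∑ v ∈ tw n y, g (y :: v) := by
  rw [tw, Finset.sum_biUnion]
  · apply Finset.sum_congr rfl
    intro y _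
    rw [Finset.sum_image]
    intro a _ b _ h
    simpa using h
  · intro a _ b _ hab
    simp only [Function.onFun]
    rw [Finset.disjoint_left]
    intro l h1 h2
    simp only [Finset.mem_image] at h1 h2
    obtain ⟨u, _, rfl⟩ := h1
    obtain ⟨u', _, h⟩ := h2
    simp only [List.cons.injEq] at h
    exact hab h.1.symm

theorem card_ne {k : ℕ} (hk : 2 ≤ k) (x : Letter k) :
    ((Finset.univ.filter (fun y => y ≠ x)).card : ℝ) = 2 * k - 1 := by
  rw [Finset.filter_ne', Finset.card_erase_of_mem (Finset.mem_univ _), Finset.card_univ,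
    Nat.cast_sub]
  · simp; ring
  · simp; omega

theorem card_tw {k : ℕ} (hk : 2 ≤ k) (n : ℕ) : ∀ x : Letter k,
    ((tw n x).card : ℝ) = (2 * k - 1) ^ n := by
  induction n with
  | zero => intro x; simp [tw]
  | succ n ih =>
    intro x
    have := sum_tw n x (fun _ => 1)
    simp only [Finset.sum_const, nsmul_eq_mul, mul_one] at this
    rw [this, Finset.sum_congr rfl (fun y _ => ih y), Finset.sum_const, nsmul_eq_mul,
      card_ne hk, pow_succ']

theorem weight_tw {k : ℕ} (F : Letter k → Letter k → ℤ) (s l : ℝ) (hl : 0 ≤ l)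
    (hF : ∀ x, ∑ y ∈ Finset.univ.filter (fun y => y ≠ linv x), Real.exp (-s * F x y) ≤ l)
    (n : ℕ) : ∀ x : Letter k, ∑ v ∈ tw n x, Real.exp (-s * ps F x v) ≤ l ^ n := by
  induction n with
  | zero => intro x; simp [tw, ps]
  | succ n ih =>
    intro x
    rw [sum_tw]
    calc _ = ∑ y ∈ Finset.univ.filter (fun y => y ≠ linv x),
          Real.exp (-s * F x y) * ∑ v ∈ tw n y, Real.exp (-s * ps F y v) := by
            apply Finset.sum_congr rfl
            intro y _
            rw [Finset.mul_sum]
            apply Finset.sum_congr rfl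
            intro v _
            rw [← Real.exp_add]
            congr 1
            simp only [ps]; push_cast; ring
      _ ≤ ∑ y ∈ Finset.univ.filter (fun y => y ≠ linv x), Real.exp (-s * F x y) * l ^ n := by
            apply Finset.sum_le_sum
            intro y _
            exact mul_le_mul_of_nonneg_left (ih y) (Real.exp_nonneg _)
      _ ≤ l ^ (n + 1) := by
            rw [← Finset.sum_mul, pow_succ']
            exact mul_le_mul_of_nonneg_right (hF x) (by positivity)

theorem count_tw {k : ℕ} (F : Letter k → Letter k → ℤ) (s l : ℝ) (hs : 0 ≤ s) (hl : 0 ≤ l)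
    (hF : ∀ x, ∑ y ∈ Finset.univ.filter (fun y => y ≠ linv x), Real.exp (-s * F x y) ≤ l)
    (n : ℕ) (x : Letter k) (c : ℤ) (P : List (Letter k) → Prop) [DecidablePred P]
    (hP : ∀ v, P v → ps F x v ≤ c) :
    (((tw n x).filter P).card : ℝ) ≤ Real.exp (s * c) * l ^ n := by
  have h1 := weight_tw F s l hl hF n x
  have h2 : (((tw n x).filter P).card : ℝ) * Real.exp (-s * c) ≤
      ∑ v ∈ (tw n x).filter P, Real.exp (-s * ps F x v) := by
    rw [← nsmul_eq_mul]
    apply Finset.card_nsmul_le_sum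
    intro v hv
    rw [Finset.mem_filter] at hv
    apply Real.exp_le_exp.2
    have : (ps F x v : ℝ) ≤ c := by exact_mod_cast hP v hv.2
    nlinarith
  have h3 : ∑ v ∈ (tw n x).filter P, Real.exp (-s * ps F x v) ≤
      ∑ v ∈ tw n x, Real.exp (-s * ps F x v) :=
    Finset.sum_le_sum_of_subset_of_nonneg (Finset.filter_subset _ _)
      (fun _ _ _ => Real.exp_nonneg _)
  have h4 := (h2.trans h3).trans h1
  have h5 : Real.exp (s * c) * Real.exp (-s * c) = 1 := by
    rw [← Real.exp_add]; simp
  calc _ = Real.exp (s * c) * ((((tw n x).filter P).card : ℝ) * Real.exp (-s * c)) := by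
        rw [mul_left_comm, h5, mul_one]
    _ ≤ _ := mul_le_mul_of_nonneg_left h4 (Real.exp_nonneg _)

def Fw {k : ℕ} (α : Letter k) (R : Letter k → Bool) (x y : Letter k) : ℤ :=
  2 * k * fw α R x y + (if y.1 = α.1 then 1 else 0) - (if x.1 = α.1 then 1 else 0)

theorem ps_Fw {k : ℕ} (α : Letter k) (R : Letter k → Bool) (v : List (Letter k)) :
    ∀ x, ps (Fw α R) x v ≤ 2 * k * ps (fw α R) x v + 1 - (if x.1 = α.1 then 1 else 0) := by
  induction v with
  | nil => intro x; simp only [ps]; split_ifs <;> simp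
  | cons y v ih =>
    intro x
    have := ih y
    simp only [ps]
    rw [Fw]
    linarith

theorem Fw_abs {k : ℕ} (hk : 2 ≤ k) (α : Letter k) (R : Letter k → Bool) (x y : Letter k) :
    |Fw α R x y| ≤ 2 * k := by
  rw [abs_le]
  zify at hk
  unfold Fw fw
  split_ifs <;> constructor <;> linarith

theorem row_cut {k : ℕ} (α : Letter k) (R : Letter k → Bool) (h : Adm α R) (x : Letter k) :
    (2 : ℤ) ≤ ∑ z ∈ Finset.univ.filter (fun z => z ≠ x), (if R x = R z then 0 else 1) := by
  have hne : α ≠ linv α := by intro h'; have := h.h1; rw [h', h.h2] at this; cases this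
  have : ∑ z ∈ Finset.univ.filter (fun z => z ≠ x), (if R x = R z then (0 : ℤ) else 1) =
      ((Finset.univ.filter (fun z => R z ≠ R x)).card : ℤ) := by
    rw [Finset.card_filter, Finset.sum_filter]
    push_cast
    apply Finset.sum_congr rfl
    intro z _
    by_cases h1 : R x = R z
    · simp [h1]
    · have : z ≠ x := by rintro rfl; exact h1 rfl
      simp [h1, this, Ne.symm h1]
  rw [this]
  have : 1 < (Finset.univ.filter (fun z => R z ≠ R x)).card := by
    rw [Finset.one_lt_card]
    cases hx : R x
    · obtain ⟨y, hy, hy'⟩ := h.h3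
      exact ⟨α, by simp [h.h1], y, by simp [hy'], hy.symm⟩
    · obtain ⟨y, hy, hy'⟩ := h.h4
      exact ⟨linv α, by simp [h.h2], y, by simp [hy'], hy.symm⟩
  omega

theorem row_deg {k : ℕ} (α : Letter k) (x : Letter k) :
    ∑ z ∈ Finset.univ.filter (fun z => z ≠ x), (if z.1 = α.1 then 1 else 0) ≤
      (2 : ℤ) - (if x.1 = α.1 then 1 else 0) := by
  have e : ∑ z ∈ Finset.univ.filter (fun z => z ≠ x), (if z.1 = α.1 then (1 : ℤ) else 0) =
      (((Finset.univ.filter (fun z => z ≠ x)).filter (fun z => z.1 = α.1)).card : ℤ) := by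
    rw [Finset.card_filter]; push_cast; rfl
  rw [e]
  split_ifs with hx
  · have : ((Finset.univ.filter (fun z => z ≠ x)).filter (fun z => z.1 = α.1)) ⊆ {linv x} := by
      intro z hz
      simp only [Finset.mem_filter, Finset.mem_univ, true_and, Finset.mem_singleton] at *
      rcases eq_or_linv (hz.2.trans hx.symm) with h | h
      · exact absurd h hz.1
      · exact h
    have := Finset.card_le_card this
    simp only [Finset.card_singleton] at this
    omega
  · have : ((Finset.univ.filter (fun z => z ≠ x)).filter (fun z => z.1 = α.1)) ⊆ {α, linv α} := by
      intro z hz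
      simp only [Finset.mem_filter, Finset.mem_univ, true_and, Finset.mem_singleton, Finset.mem_insert] at *
      exact eq_or_linv hz.2
    have := (Finset.card_le_card this).trans Finset.card_le_two
    omega

theorem row_Fw {k : ℕ} (hk : 2 ≤ k) (α : Letter k) (R : Letter k → Bool) (h : Adm α R)
    (x : Letter k) :
    (2 : ℤ) ≤ ∑ y ∈ Finset.univ.filter (fun y => y ≠ linv x), Fw α R x y := by
  have e : ∑ y ∈ Finset.univ.filter (fun y => y ≠ linv x), Fw α R x y =
      ∑ z ∈ Finset.univ.filter (fun z => z ≠ x), (2 * (k : ℤ) * (if R x = R z then (0 : ℤ) else 1) -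
        (2 * (k : ℤ) - 1) * (if z.1 = α.1 then (1 : ℤ) else 0) - (if x.1 = α.1 then (1 : ℤ) else 0)) := by
    apply Finset.sum_bij' (fun y _ => linv y) (fun y _ => linv y)
    · intro y hy
      simp only [Finset.mem_filter, Finset.mem_univ, true_and] at *
      rintro rfl; exact hy (linv_linv _).symm
    · intro y hy
      simp only [Finset.mem_filter, Finset.mem_univ, true_and] at *
      rintro h'; apply hy; rw [← linv_linv y, h', linv_linv]
    · intro y _; exact linv_linv y
    · intro y _; exact linv_linv y
    · intro y _
      rw [Fw, fw, linv_fst]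
      ring
  rw [e, Finset.sum_sub_distrib, Finset.sum_sub_distrib, ← Finset.mul_sum, ← Finset.mul_sum,
    Finset.sum_const, nsmul_eq_mul]
  have c : ((Finset.univ.filter (fun z => z ≠ x)).card : ℤ) = 2 * k - 1 := by
    have := card_ne hk x
    exact_mod_cast this
  rw [c]
  have r1 := row_cut α R h x
  have r2 := row_deg α x
  zify at hk
  have r3 : (2 * k : ℤ) * 2 ≤ 2 * k * ∑ z ∈ Finset.univ.filter (fun z => z ≠ x), (if R x = R z then (0:ℤ) else 1) :=
    mul_le_mul_of_nonneg_left r1 (by positivity)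
  have r4 := mul_le_mul_of_nonneg_left r2 (show (0:ℤ) ≤ 2 * k - 1 by linarith)
  split_ifs at * <;> linarith

theorem exp_row {k : ℕ} (hk : 2 ≤ k) (α : Letter k) (R : Letter k → Bool) (h : Adm α R)
    (x : Letter k) :
    ∑ y ∈ Finset.univ.filter (fun y => y ≠ linv x), Real.exp (-(1 / (8 * k ^ 3) : ℝ) * Fw α R x y)
      ≤ 2 * k - 1 - 1 / (8 * k ^ 3) := by
  set s : ℝ := 1 / (8 * k ^ 3) with hs
  have hk' : (2 : ℝ) ≤ k := by exact_mod_cast hk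
  have hs0 : 0 < s := by positivity
  have hsk : s * (8 * k ^ 3) = 1 := by rw [hs]; field_simp
  have b : ∀ y, |(Fw α R x y : ℝ)| ≤ 2 * k := fun y => by exact_mod_cast Fw_abs hk α R x y
  have hs1 : s * (2 * k) ≤ 1 := by
    rw [← hsk]
    apply mul_le_mul_of_nonneg_left _ hs0.le
    nlinarith [mul_nonneg (show (0:ℝ) ≤ k - 2 by linarith) (show (0:ℝ) ≤ k by linarith), pow_pos (show (0:ℝ) < k by linarith) 2, pow_pos (show (0:ℝ) < k by linarith) 3]
  have p : ∀ y, Real.exp (-s * Fw α R x y) ≤ 1 - s * Fw α R x y + s ^ 2 * (2 * k) ^ 2 := by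
    intro y
    have q1 : |-s * (Fw α R x y : ℝ)| ≤ 1 := by
      rw [abs_mul, abs_neg, abs_of_pos hs0]
      exact (mul_le_mul_of_nonneg_left (b y) hs0.le).trans hs1
    have q2 := (abs_le.1 (Real.abs_exp_sub_one_sub_id_le q1)).2
    have q3 : (Fw α R x y : ℝ) ^ 2 ≤ (2 * k) ^ 2 := by
      rw [← sq_abs]; exact pow_le_pow_left₀ (abs_nonneg _) (b y) 2
    have q4 := mul_le_mul_of_nonneg_left q3 (sq_nonneg s)
    nlinarith
  calc _ ≤ ∑ y ∈ Finset.univ.filter (fun y => y ≠ linv x), (1 - s * Fw α R x y + s ^ 2 * (2 * k) ^ 2) :=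
        Finset.sum_le_sum (fun y _ => p y)
    _ = (2 * k - 1) - s * ∑ y ∈ Finset.univ.filter (fun y => y ≠ linv x), (Fw α R x y : ℝ)
          + (2 * k - 1) * (s ^ 2 * (2 * k) ^ 2) := by
        rw [Finset.sum_add_distrib, Finset.sum_sub_distrib, Finset.sum_const, Finset.sum_const,
          nsmul_eq_mul, nsmul_eq_mul, card_ne hk, Finset.mul_sum, mul_one]
    _ ≤ _ := by
        have r : (2 : ℝ) ≤ ∑ y ∈ Finset.univ.filter (fun y => y ≠ linv x), (Fw α R x y : ℝ) := by
          exact_mod_cast row_Fw hk α R h x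
        have r1 := mul_le_mul_of_nonneg_left r hs0.le
        have r2 : (2 * k - 1) * (s ^ 2 * (2 * k) ^ 2) ≤ s := by
          calc _ ≤ (2 * k) * (s ^ 2 * (2 * k) ^ 2) := by
                apply mul_le_mul_of_nonneg_right _ (by positivity); linarith
            _ = s * (s * (8 * k ^ 3)) := by ring
            _ = s := by rw [hsk, mul_one]
        linarith

theorem gamma_bad {k : ℕ} (hk : 2 ≤ k) : ∃ K : ℝ, 0 < K ∧ ∃ l : ℝ, 1 ≤ l ∧ l < 2 * k - 1 ∧
    ∀ n, (gammaC (Cset k \ SM k) n : ℝ) ≤ K * l ^ n := by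
  classical
  set s : ℝ := 1 / (8 * k ^ 3) with hs
  have hk' : (2 : ℝ) ≤ k := by exact_mod_cast hk
  have hs0 : 0 < s := by positivity
  have hs1 : s ≤ 1 := by
    rw [hs, div_le_one (by positivity)]
    nlinarith [pow_le_pow_left₀ (by norm_num) hk' 3]
  set l : ℝ := 2 * k - 1 - s with hl
  have hl1 : 1 ≤ l := by linarith
  let N : ℕ := Fintype.card (Letter k × (Letter k → Bool) × Letter k)
  let c : ℤ := 2 * k + 1
  refine ⟨N * Real.exp (s * c) + 1, by positivity, l, hl1, by linarith, ?_⟩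
  intro n
  cases n with
  | zero =>
    have : gammaC (Cset k \ SM k) 0 ≤ 1 := by
      rw [gammaC, ← Set.ncard_singleton (1 : FG k)]
      apply Set.ncard_le_ncard _ (Set.finite_singleton _)
      rintro g ⟨_, hg⟩
      simpa [wordLength] using hg
    have h : (gammaC (Cset k \ SM k) 0 : ℝ) ≤ 1 := by exact_mod_cast this
    have : 0 ≤ N * Real.exp (s * c) := by positivity
    simp only [pow_zero, mul_one]; linarith
  | succ n =>
    let E : Letter k × (Letter k → Bool) × Letter k → Finset (List (Letter k)) := fun p =>
      ((tw n p.2.2).filter (fun v => Adm p.1 p.2.1 ∧ ps (fw p.1 p.2.1) p.2.2 v ≤ 1)).image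
        (fun v => p.2.2 :: v)
    have h1 : gammaC (Cset k \ SM k) (n + 1) ≤ (Finset.univ.biUnion E).card := by
      rw [gammaC, ← Set.ncard_coe_finset]
      apply Set.ncard_le_ncard_of_injOn FreeGroup.toWord _ (FreeGroup.toWord_injective.injOn)
        (Finset.finite_toSet _)
      rintro g ⟨⟨hg1, hg2⟩, hg3⟩
      simp only [wordLength] at hg3
      obtain ⟨x, v, hxv⟩ : ∃ x v, g.toWord = x :: v := by
        cases h : g.toWord with
        | nil => simp [h] at hg3
        | cons x v => exact ⟨x, v, rfl⟩
      obtain ⟨α, R, hA, hps⟩ := bad_data g hg1 hg2 x v hxv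
      simp only [Finset.coe_biUnion, Set.mem_iUnion]
      refine ⟨(α, R, x), by simp, ?_⟩
      simp only [E, Finset.coe_image, Set.mem_image, Finset.mem_coe, Finset.mem_filter, mem_tw]
      refine ⟨v, ⟨⟨?_, ?_⟩, hA, hps⟩, hxv.symm⟩
      · rw [hxv] at hg3; simpa using hg3
      · rw [← hxv]; exact FreeGroup.isReduced_toWord
    have h2 : ∀ p, ((E p).card : ℝ) ≤ Real.exp (s * c) * l ^ n := by
      rintro ⟨α, R, x⟩
      by_cases hA : Adm α R
      · have := count_tw (Fw α R) s l hs0.le (by linarith) (exp_row hk α R hA) n x c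
          (fun v => Adm α R ∧ ps (fw α R) x v ≤ 1) (by
            rintro v ⟨_, hv⟩
            have := ps_Fw α R v x
            have h' := mul_le_mul_of_nonneg_left hv (show (0:ℤ) ≤ 2 * k by positivity)
            simp only [c]
            split_ifs at this <;> linarith)
        refine le_trans ?_ this
        exact_mod_cast Finset.card_image_le
      · have : E (α, R, x) = ∅ := by simp [E, hA]
        rw [this]; simp; positivity
    have h3 : ((Finset.univ.biUnion E).card : ℝ) ≤ N * (Real.exp (s * c) * l ^ n) := by
      calc _ ≤ ∑ p, ((E p).card : ℝ) := by exact_mod_cast Finset.card_biUnion_le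
        _ ≤ ∑ p : Letter k × (Letter k → Bool) × Letter k, Real.exp (s * c) * l ^ n :=
          Finset.sum_le_sum (fun p _ => h2 p)
        _ = _ := by rw [Finset.sum_const, nsmul_eq_mul, Finset.card_univ]
    have h4 : (gammaC (Cset k \ SM k) (n + 1) : ℝ) ≤ (Finset.univ.biUnion E).card := by
      exact_mod_cast h1
    have h5 : l ^ n ≤ l ^ (n + 1) := pow_le_pow_right₀ hl1 (by omega)
    have h6 : N * Real.exp (s * c) * l ^ n ≤ N * Real.exp (s * c) * l ^ (n + 1) :=
      mul_le_mul_of_nonneg_left h5 (by positivity)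
    have h7 : 0 ≤ l ^ (n + 1) := by positivity
    linarith


theorem fin_le {k : ℕ} (S : Set (FG k)) (n : ℕ) : {g ∈ S | wordLength g ≤ n}.Finite := by
  apply Set.Finite.of_finite_image (f := FreeGroup.toWord)
    ((List.finite_length_le (Letter k) n).subset _) FreeGroup.toWord_injective.injOn
  rintro _ ⟨g, ⟨_, hg⟩, rfl⟩
  exact hg

theorem fin_eq {k : ℕ} (S : Set (FG k)) (n : ℕ) : {g ∈ S | wordLength g = n}.Finite :=
  (fin_le S n).subset (fun _ h => ⟨h.1, h.2.le⟩)

theorem rho_mono {k : ℕ} {S T : Set (FG k)} (h : S ⊆ T) (n : ℕ) : rhoC S n ≤ rhoC T n :=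
  Set.ncard_le_ncard (fun _ hg => ⟨h hg.1, hg.2⟩) (fin_le T n)

theorem rho_diff {k : ℕ} {B S : Set (FG k)} (h : B ⊆ S) (n : ℕ) :
    rhoC B n + rhoC (S \ B) n = rhoC S n := by
  rw [rhoC, rhoC, rhoC, ← Set.ncard_union_eq _ (fin_le _ _) (fin_le _ _)]
  · congr 1
    ext g
    simp only [Set.mem_union, Set.mem_setOf_eq, Set.mem_diff]
    have := @h g
    tauto
  · rw [Set.disjoint_left]
    rintro g hg1 hg2
    exact hg2.1.2 hg1.1

theorem exists_y {k : ℕ} (hk : 2 ≤ k) (a b : Letter k) : ∃ y : Letter k, y ≠ a ∧ y ≠ b := by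
  have : ({a, b} : Finset (Letter k)).card < (Finset.univ : Finset (Letter k)).card := by
    refine lt_of_le_of_lt Finset.card_le_two ?_
    simp; omega
  obtain ⟨y, _, hy⟩ := Finset.exists_mem_notMem_of_card_lt_card this
  simp only [Finset.mem_insert, Finset.mem_singleton, not_or] at hy
  exact ⟨y, hy⟩

theorem gammaC_C {k : ℕ} (hk : 2 ≤ k) (n : ℕ) :
    ((2 * k - 1 : ℝ)) ^ n ≤ gammaC (Cset k) (n + 2) := by
  let x : Letter k := (⟨0, by omega⟩, true)
  rw [← card_tw hk n x]
  choose Y hY1 hY2 using fun v : List (Letter k) =>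
    exists_y hk (linv x) (linv ((x :: v).getLast (by simp)))
  have hred : ∀ v ∈ tw n x, FreeGroup.IsCyclicallyReduced (x :: v ++ [Y v]) := by
    intro v hv
    rw [mem_tw] at hv
    rw [FreeGroup.isCyclicallyReduced_cons_append_iff]
    constructor
    · rw [FreeGroup.IsReduced, List.isChain_append]
      refine ⟨hv.2, by simp, ?_⟩
      intro a ha b hb
      simp only [List.head?_cons, Option.mem_def, Option.some.injEq] at hb
      subst hb
      rw [List.getLast?_eq_getLast (by simp)] at ha
      simp only [Option.mem_def, Option.some.injEq] at ha
      subst ha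
      rw [rel_iff]
      exact hY2 v
    · rw [rel_iff]
      intro h
      apply hY1 v
      rw [h, linv_linv]
  have hw : ∀ v ∈ tw n x, (FreeGroup.mk (x :: v ++ [Y v])).toWord = x :: v ++ [Y v] := by
    intro v hv
    rw [FreeGroup.toWord_mk, (hred v hv).1.reduce_eq]
  have : (tw n x).card ≤ gammaC (Cset k) (n + 2) := by
    rw [gammaC, ← Set.ncard_coe_finset]
    apply Set.ncard_le_ncard_of_injOn (fun v => FreeGroup.mk (x :: v ++ [Y v])) _ _ (fin_eq _ _)
    · intro v hv
      rw [Finset.mem_coe] at hv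
      refine ⟨?_, ?_⟩
      · change CyclicallyReducedWord _
        rw [hw v hv, cyc_iff]; exact hred v hv
      · rw [wordLength, hw v hv]
        have := ((mem_tw _ _ _).1 hv).1
        simp [this]
    · intro v hv u hu h
      rw [Finset.mem_coe] at hv hu
      have h' := congrArg FreeGroup.toWord h
      simp only [hw v hv, hw u hu] at h'
      have := List.append_inj_left' h' rfl
      simpa using this
  exact_mod_cast this

theorem rho_C {k : ℕ} (hk : 2 ≤ k) (n : ℕ) :
    ((2 * k - 1 : ℝ)) ^ n / (2 * k - 1) ^ 2 ≤ rhoC (Cset k) n := by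
  have hk' : (2 : ℝ) ≤ k := by exact_mod_cast hk
  have hD : (1 : ℝ) ≤ 2 * k - 1 := by linarith
  rw [div_le_iff₀ (by positivity)]
  by_cases hn : n < 2
  · have h1 : 1 ≤ rhoC (Cset k) n := by
      rw [rhoC, Nat.succ_le_iff, Set.ncard_pos (fin_le _ _)]
      refine ⟨1, ?_, ?_⟩
      · change CyclicallyReducedWord _
        rw [cyc_iff]; simp
      · simp [wordLength]
    have h2 : (1 : ℝ) ≤ rhoC (Cset k) n := by exact_mod_cast h1
    calc ((2 * k - 1 : ℝ)) ^ n ≤ (2 * k - 1) ^ 2 := pow_le_pow_right₀ hD (by omega)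
      _ ≤ _ := by nlinarith [sq_nonneg (2 * k - 1 : ℝ)]
  · obtain ⟨m, rfl⟩ : ∃ m, n = m + 2 := ⟨n - 2, by omega⟩
    rw [pow_add]
    apply mul_le_mul_of_nonneg_right _ (by positivity)
    refine (gammaC_C hk m).trans ?_
    have : gammaC (Cset k) (m + 2) ≤ rhoC (Cset k) (m + 2) :=
      Set.ncard_le_ncard (fun _ h => ⟨h.1, h.2.le⟩) (fin_le _ _)
    exact_mod_cast this

theorem poly_bound (r : ℝ) (h0 : 0 < r) (h1 : r < 1) :
    ∃ M : ℝ, 0 < M ∧ ∀ n : ℕ, ((n : ℝ) + 1) ^ 2 * r ^ n ≤ M := by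
  have h := tendsto_pow_const_mul_const_pow_of_abs_lt_one 2 (r := r) (by rwa [abs_of_pos h0])
  obtain ⟨M, hM⟩ := h.bddAbove_range
  have hM' : ∀ n : ℕ, ((n : ℝ)) ^ 2 * r ^ n ≤ M := fun n => hM ⟨n, rfl⟩
  refine ⟨(|M| + 1) / r, by positivity, fun n => ?_⟩
  rw [le_div_iff₀ h0]
  have := hM' (n + 1)
  push_cast at this
  have h3 := le_abs_self M
  calc _ = ((n : ℝ) + 1) ^ 2 * r ^ (n + 1) := by ring
    _ ≤ _ := by linarith

theorem generic_of {k : ℕ} (hk : 2 ≤ k) {B S : Set (FG k)} (h : B ⊆ S) (hS : Cset k ⊆ S)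
    (K l : ℝ) (hK : 0 < K) (hl : 0 < l) (hl' : l < 2 * k - 1)
    (hb : ∀ n, (rhoC (S \ B) n : ℝ) ≤ K * ((n : ℝ) + 1) ^ 2 * l ^ n) : ExpGenericIn B S := by
  refine ⟨h, ?_⟩
  set D : ℝ := 2 * k - 1 with hD
  have hD0 : 0 < D := hl.trans hl'
  set σ : ℝ := Real.sqrt (l / D) with hσ
  have hr0 : 0 < l / D := by positivity
  have hr1 : l / D < 1 := by rw [div_lt_one hD0]; exact hl'
  have hσ0 : 0 < σ := Real.sqrt_pos.2 hr0
  have hσ1 : σ < 1 := by rw [hσ, Real.sqrt_lt' one_pos]; simpa using hr1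
  have hσ2 : σ ^ 2 = l / D := Real.sq_sqrt hr0.le
  obtain ⟨M, hM0, hM⟩ := poly_bound σ hσ0 hσ1
  refine ⟨K * D ^ 2 * M, by positivity, σ, hσ0, hσ1, fun n => ?_⟩
  have e1 : (rhoC B n : ℝ) + rhoC (S \ B) n = rhoC S n := by exact_mod_cast rho_diff h n
  have e2 : D ^ n / D ^ 2 ≤ rhoC S n :=
    (rho_C hk n).trans (by exact_mod_cast rho_mono hS n)
  have e3 : 0 < D ^ n / D ^ 2 := by positivity
  have e4 : (0 : ℝ) < rhoC S n := e3.trans_le e2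
  have e5 : 1 - (rhoC B n : ℝ) / rhoC S n = rhoC (S \ B) n / rhoC S n := by
    rw [← e1] at e4 ⊢
    field_simp
    ring
  rw [e5, abs_of_nonneg (by positivity)]
  calc (rhoC (S \ B) n : ℝ) / rhoC S n ≤ (K * ((n : ℝ) + 1) ^ 2 * l ^ n) / (D ^ n / D ^ 2) :=
        div_le_div₀ (by positivity) (hb n) e3 e2
    _ = K * D ^ 2 * (((n : ℝ) + 1) ^ 2 * (l / D) ^ n) := by
        rw [div_pow]; field_simp
    _ = K * D ^ 2 * (((n : ℝ) + 1) ^ 2 * σ ^ n) * σ ^ n := by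
        rw [← hσ2]; ring
    _ ≤ _ := by
        apply mul_le_mul_of_nonneg_right _ (by positivity)
        exact mul_le_mul_of_nonneg_left (hM n) (by positivity)

theorem main_C {k : ℕ} (hk : 2 ≤ k) : ExpGenericIn (SM k) (Cset k) := by
  classical
  obtain ⟨K, hK, l, hl1, hl2, hb⟩ := gamma_bad hk
  refine generic_of hk (fun _ h => h.1) (fun _ h => h) K l hK (by linarith) hl2 fun n => ?_
  let E : ℕ → Finset (FG k) := fun q => (fin_eq (Cset k \ SM k) q).toFinset
  have hE : ∀ q, (E q).card = gammaC (Cset k \ SM k) q := fun q => by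
    rw [gammaC, Set.ncard_eq_toFinset_card _ (fin_eq (Cset k \ SM k) q)]
  have h1 : rhoC (Cset k \ SM k) n ≤ ((Finset.range (n + 1)).biUnion E).card := by
    rw [rhoC, ← Set.ncard_coe_finset]
    apply Set.ncard_le_ncard _ (Finset.finite_toSet _)
    rintro g ⟨hg, hgn⟩
    simp only [Finset.coe_biUnion, Set.mem_iUnion]
    refine ⟨wordLength g, by simp; omega, ?_⟩
    simp only [E, Set.Finite.coe_toFinset]
    exact ⟨hg, rfl⟩
  have h2 : (((Finset.range (n + 1)).biUnion E).card : ℝ) ≤ ∑ q ∈ Finset.range (n + 1), K * l ^ n := by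
    calc _ ≤ ∑ q ∈ Finset.range (n + 1), ((E q).card : ℝ) := by
          exact_mod_cast Finset.card_biUnion_le
      _ ≤ _ := by
          apply Finset.sum_le_sum
          intro q hq
          rw [Finset.mem_range] at hq
          rw [hE]
          refine (hb q).trans ?_
          exact mul_le_mul_of_nonneg_left (pow_le_pow_right₀ hl1 (by omega)) hK.le
  rw [Finset.sum_const, nsmul_eq_mul, Finset.card_range] at h2
  have h3 : (rhoC (Cset k \ SM k) n : ℝ) ≤ ((Finset.range (n + 1)).biUnion E).card := by
    exact_mod_cast h1
  have h4 : ((n + 1 : ℕ) : ℝ) ≤ ((n : ℝ) + 1) ^ 2 := by push_cast; nlinarith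
  have h5 : ((n + 1 : ℕ) : ℝ) * (K * l ^ n) ≤ ((n : ℝ) + 1) ^ 2 * (K * l ^ n) :=
    mul_le_mul_of_nonneg_right h4 (by positivity)
  linarith

theorem main_F {k : ℕ} (hk : 2 ≤ k) : ExpGenericIn (SM' k) (Set.univ : Set (FG k)) := by
  classical
  obtain ⟨K, hK, l, hl1, hl2, hb⟩ := gamma_bad hk
  have hk' : (2 : ℝ) ≤ k := by exact_mod_cast hk
  set μ : ℝ := max l (Real.sqrt (2 * k)) with hμ
  have hμl : l ≤ μ := le_max_left _ _
  have hμ1 : 1 ≤ μ := hl1.trans hμl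
  have hμk : (2 * k : ℝ) ≤ μ ^ 2 := by
    rw [← Real.sq_sqrt (show (0 : ℝ) ≤ 2 * k by positivity)]
    exact pow_le_pow_left₀ (Real.sqrt_nonneg _) (le_max_right _ _) 2
  have hμD : μ < 2 * k - 1 := by
    apply max_lt hl2
    rw [Real.sqrt_lt' (by linarith)]
    nlinarith
  refine generic_of hk (Set.subset_univ _) (Set.subset_univ _) K μ hK (by linarith) hμD fun n => ?_
  let Q : ℕ → Finset (FG k) := fun q => (fin_eq (Cset k \ SM k) q).toFinset
  have hQ : ∀ q, (Q q).card = gammaC (Cset k \ SM k) q := fun q => by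
    rw [gammaC, Set.ncard_eq_toFinset_card _ (fin_eq (Cset k \ SM k) q)]
  let E : ℕ × ℕ → Finset (FG k) := fun p =>
    ((Finset.univ : Finset (Fin p.1 → Letter k)) ×ˢ Q p.2).image
      (fun t => FreeGroup.mk (List.ofFn t.1) * t.2 * (FreeGroup.mk (List.ofFn t.1))⁻¹)
  let I : Finset (ℕ × ℕ) := (Finset.range (n + 1) ×ˢ Finset.range (n + 1)).filter
    (fun p => 2 * p.1 + p.2 ≤ n)
  have hI : I.card ≤ (n + 1) ^ 2 := by
    refine (Finset.card_filter_le _ _).trans ?_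
    simp [sq]
  have h1 : rhoC (Set.univ \ SM' k) n ≤ (I.biUnion E).card := by
    rw [rhoC, ← Set.ncard_coe_finset]
    apply Set.ncard_le_ncard _ (Finset.finite_toSet _)
    rintro g ⟨⟨_, hg⟩, hgn⟩
    obtain ⟨x, u, hu, hgx, hlen⟩ := exists_cyc g
    simp only [Finset.coe_biUnion, Set.mem_iUnion]
    refine ⟨(wordLength x, wordLength u), ?_, ?_⟩
    · simp only [I, Finset.coe_filter, Set.mem_setOf_eq, Finset.mem_product, Finset.mem_range]
      omega
    · simp only [E, Finset.mem_coe, Finset.mem_image, Finset.mem_product, Finset.mem_univ, true_and]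
      refine ⟨(x.toWord.get, u), ?_, ?_⟩
      · simp only [Q, Set.Finite.mem_toFinset]
        exact ⟨⟨hu, fun h => hg ⟨x, u, h, hgx⟩⟩, rfl⟩
      · have : List.ofFn (x.toWord.get) = x.toWord := List.ofFn_get _
        rw [hgx]
        change FreeGroup.mk (List.ofFn x.toWord.get) * u * (FreeGroup.mk (List.ofFn x.toWord.get))⁻¹ = _
        rw [this, FreeGroup.mk_toWord]
  have h2 : ∀ p ∈ I, ((E p).card : ℝ) ≤ K * μ ^ n := by
    rintro ⟨p, q⟩ hp
    have hpq : 2 * p + q ≤ n := (Finset.mem_filter.1 hp).2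
    have : (E (p, q)).card ≤ (2 * k) ^ p * (Q q).card := by
      refine Finset.card_image_le.trans ?_
      rw [Finset.card_product, Finset.card_univ]
      simp [mul_comm]
    calc ((E (p, q)).card : ℝ) ≤ (2 * k) ^ p * (Q q).card := by exact_mod_cast this
      _ ≤ (μ ^ 2) ^ p * (K * μ ^ q) := by
          apply mul_le_mul (pow_le_pow_left₀ (by positivity) hμk p) _ (by positivity) (by positivity)
          rw [hQ]
          refine (hb q).trans ?_
          exact mul_le_mul_of_nonneg_left (pow_le_pow_left₀ (by linarith) hμl q) hK.le
      _ = K * μ ^ (2 * p + q) := by ring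
      _ ≤ _ := mul_le_mul_of_nonneg_left (pow_le_pow_right₀ hμ1 hpq) hK.le
  have h3 : ((I.biUnion E).card : ℝ) ≤ I.card * (K * μ ^ n) := by
    calc _ ≤ ∑ p ∈ I, ((E p).card : ℝ) := by exact_mod_cast Finset.card_biUnion_le
      _ ≤ ∑ p ∈ I, K * μ ^ n := Finset.sum_le_sum h2
      _ = _ := by rw [Finset.sum_const, nsmul_eq_mul]
  have h4 : (rhoC (Set.univ \ SM' k) n : ℝ) ≤ (I.biUnion E).card := by exact_mod_cast h1
  have h5 : (I.card : ℝ) ≤ ((n : ℝ) + 1) ^ 2 := by exact_mod_cast hI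
  have h6 : (I.card : ℝ) * (K * μ ^ n) ≤ ((n : ℝ) + 1) ^ 2 * (K * μ ^ n) :=
    mul_le_mul_of_nonneg_right h5 (by positivity)
  linarith

end WH

/-- `SM` is exponentially generic in `C` and `SM'` is exponentially
generic in `F_k`. -/
theorem SM_expGeneric (k : ℕ) (hk : 2 ≤ k) :
    ExpGenericIn (SM k) (Cset k) ∧ ExpGenericIn (SM' k) (Set.univ : Set (FG k)) := by
  exact ⟨WH.main_C hk, WH.main_F hk⟩
end

section
/- Every strictly minimal cyclically reduced word w ∈ SM is minimal in its Aut(F_k)-orbit, that is, |w| ≤ |α(w)| for every α ∈ Aut(F_k). Moreover, if w ∈ SM and v is a cyclically reduced word with |w| = |v|, then v lies in the orbit Aut(F_k)w if and only if there exists a Whitehead automorphism τ of the first kind such that τ(w) is a cyclic permutation of v. -/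
open Function in
/-- almost invariant functions -/
def AI {k : ℕ} (f : FG k → ℤ) : Prop := ∀ h, HasFiniteSupport fun g => f (g * h) - f g

noncomputable def dd {k : ℕ} (f : FG k → ℤ) (h : FG k) : ℤ := ∑ᶠ g, |f (g * h) - f g|
noncomputable def cc {k : ℕ} (f : FG k → ℤ) (h : FG k) : ℤ := ∑ᶠ g, (f (g * h) - f g)

section AIsec
open Function
variable {k : ℕ}

lemma hfs_shift {f : FG k → ℤ} (hf : HasFiniteSupport f) (e : FG k ≃ FG k) :
    HasFiniteSupport fun g => f (e g) := by
  have := Set.Finite.preimage (e.injective.injOn (s := e ⁻¹' support f)) hf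
  exact this

lemma hfs_abs {f : FG k → ℤ} (hf : HasFiniteSupport f) :
    HasFiniteSupport fun g => |f g| := by
  refine Set.Finite.subset hf ?_
  intro g hg
  simpa using hg

lemma AI.gen {f : FG k → ℤ} (hf : ∀ i, HasFiniteSupport fun g => f (g * FreeGroup.of i) - f g) :
    AI f := by
  intro h
  induction h using FreeGroup.induction_on with
  | C1 => simp; exact Set.finite_empty.subset (by simp [Function.support])
  | of i => exact hf i
  | inv_of i ih =>
    refine Set.Finite.subset (hfs_shift ih (Equiv.mulRight (FreeGroup.of i)⁻¹)) ?_
    intro g hg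
    simp at hg ⊢
    intro h; apply hg; linarith
  | mul x y hx hy =>
    refine Set.Finite.subset (hx.union (hfs_shift hy (Equiv.mulRight x))) ?_
    intro g hg
    simp [mul_assoc] at hg ⊢
    by_contra hc
    push Not at hc
    apply hg; linarith [hc.1, hc.2]

lemma AI.add {f f' : FG k → ℤ} (hf : AI f) (hf' : AI f') : AI (f + f') := by
  intro h
  refine Set.Finite.subset ((hf h).union (hf' h)) ?_
  intro g hg
  simp at hg ⊢
  by_contra hc
  push Not at hc
  apply hg; linarith [hc.1, hc.2]

lemma AI.fin {e : FG k → ℤ} (he : HasFiniteSupport e) : AI e := by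
  intro h
  refine Set.Finite.subset ((hfs_shift he (Equiv.mulRight h)).union he) ?_
  intro g hg
  simp at hg ⊢
  by_contra hc
  push Not at hc
  apply hg; linarith [hc.1, hc.2]

lemma AI.tr {f : FG k → ℤ} (hf : AI f) (u : FG k) : AI (fun g => f (u * g)) := by
  intro h
  have := hfs_shift (hf h) (Equiv.mulLeft u)
  simpa [mul_assoc] using this

lemma AI.aut {f : FG k → ℤ} (hf : AI f) (β : MulAut (FG k)) : AI (fun g => f (β g)) := by
  intro h
  have := hfs_shift (hf (β h)) β.toEquiv
  simpa [mul_assoc] using this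

lemma dd_nonneg (f : FG k → ℤ) (h) : 0 ≤ dd f h := finsum_nonneg fun _ => abs_nonneg _

lemma dd_tr (f : FG k → ℤ) (u h) : dd (fun g => f (u * g)) h = dd f h := by
  unfold dd
  symm
  rw [← finsum_comp_equiv (Equiv.mulLeft u)]
  simp [mul_assoc]

lemma cc_tr (f : FG k → ℤ) (u h) : cc (fun g => f (u * g)) h = cc f h := by
  unfold cc
  symm
  rw [← finsum_comp_equiv (Equiv.mulLeft u)]
  simp [mul_assoc]

lemma dd_aut (f : FG k → ℤ) (β : MulAut (FG k)) (h) : dd (fun g => f (β g)) h = dd f (β h) := by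
  unfold dd
  symm
  rw [← finsum_comp_equiv β.toEquiv]
  simp

lemma cc_aut (f : FG k → ℤ) (β : MulAut (FG k)) (h) : cc (fun g => f (β g)) h = cc f (β h) := by
  unfold cc
  symm
  rw [← finsum_comp_equiv β.toEquiv]
  simp

lemma dd_mul_le {f : FG k → ℤ} (hf : AI f) (x y) : dd f (x * y) ≤ dd f x + dd f y := by
  have e : dd f y = ∑ᶠ g, |f (g * x * y) - f (g * x)| := by
    unfold dd
    rw [← finsum_comp_equiv (Equiv.mulRight x)]
    simp
  have h1 := hfs_abs (hfs_shift (hf y) (Equiv.mulRight x))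
  simp at h1
  rw [e]
  unfold dd
  rw [← finsum_add_distrib (hfs_abs (hf x)) h1]
  refine finsum_le_finsum' (hfs_abs (hf _)) ((hfs_abs (hf x)).add h1) ?_
  intro g
  simp only [mul_assoc]
  have := abs_add_le (f (g * (x * y)) - f (g * x)) (f (g * x) - f g)
  simp at this
  linarith

lemma cc_mul {f : FG k → ℤ} (hf : AI f) (x y) : cc f (x * y) = cc f x + cc f y := by
  have e : cc f y = ∑ᶠ g, (f (g * x * y) - f (g * x)) := by
    unfold cc
    rw [← finsum_comp_equiv (Equiv.mulRight x)]
    simp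
  have h1 := (hfs_shift (hf y) (Equiv.mulRight x))
  simp at h1
  rw [e]
  unfold cc
  rw [← finsum_add_distrib ((hf x)) h1]
  refine finsum_congr ?_
  intro g
  simp only [mul_assoc]
  ring

lemma cc_add {f f' : FG k → ℤ} (hf : AI f) (hf' : AI f') (h) :
    cc (f + f') h = cc f h + cc f' h := by
  unfold cc
  rw [← finsum_add_distrib (hf h) (hf' h)]
  refine finsum_congr ?_
  intro g
  simp; ring

lemma cc_fin {e : FG k → ℤ} (he : HasFiniteSupport e) (h) : cc e h = 0 := by
  unfold cc
  have h1 := hfs_shift he (Equiv.mulRight h)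
  simp at h1
  rw [finsum_sub_distrib h1 he, sub_eq_zero]
  exact finsum_comp_equiv (Equiv.mulRight h)

lemma dd_add_le {f f' : FG k → ℤ} (hf : AI f) (hf' : AI f') (h) :
    dd (f + f') h ≤ dd f h + dd f' h := by
  unfold dd
  rw [← finsum_add_distrib (hfs_abs (hf h)) (hfs_abs (hf' h))]
  refine finsum_le_finsum' (hfs_abs ((hf.add hf') _)) ((hfs_abs (hf h)).add (hfs_abs (hf' h))) ?_
  intro g
  have := abs_add_le (f (g * h) - f g) (f' (g * h) - f' g)
  have e : (f + f') (g * h) - (f + f') g = (f (g * h) - f g) + (f' (g * h) - f' g) := by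
    simp only [Pi.add_apply]; ring
  simpa only [e] using this

lemma dd_fin {e : FG k → ℤ} (he : HasFiniteSupport e) (h) : dd e h ≤ 2 * ∑ᶠ g, |e g| := by
  have h1 := hfs_abs (hfs_shift he (Equiv.mulRight h))
  simp at h1
  have e1 : ∑ᶠ g, |e g| = ∑ᶠ g, |e (g * h)| := by
    rw [← finsum_comp_equiv (Equiv.mulRight h)]; simp
  rw [two_mul]
  nth_rewrite 1 [e1]
  rw [← finsum_add_distrib h1 (hfs_abs he)]
  refine finsum_le_finsum' (hfs_abs ((AI.fin he) _)) (h1.add (hfs_abs he)) ?_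
  intro g
  simpa using abs_sub (e (g * h)) (e g)

/-- indicator -/
noncomputable def ind (E : Set (FG k)) : FG k → ℤ := E.indicator 1

lemma ind_of_mem {E : Set (FG k)} {g} (h : g ∈ E) : ind E g = 1 := by simp [ind, h]
lemma ind_of_notMem {E : Set (FG k)} {g} (h : g ∉ E) : ind E g = 0 := by simp [ind, h]

lemma ind_union_inter (E H : Set (FG k)) : ind (E ∪ H) + ind (E ∩ H) = ind E + ind H := by
  exact Set.indicator_union_add_inter _ _ _

lemma AI.union {E H : Set (FG k)} (hE : AI (ind E)) (hH : AI (ind H)) : AI (ind (E ∪ H)) := by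
  intro h
  refine Set.Finite.subset ((hE h).union (hH h)) ?_
  intro g
  simp only [Function.mem_support, Set.mem_union]
  contrapose!
  rintro ⟨h1, h2⟩
  by_cases a : g ∈ E <;> by_cases b : g ∈ H <;> by_cases c : g * h ∈ E <;> by_cases d : g * h ∈ H <;>
    simp_all [ind]

lemma AI.compl {E : Set (FG k)} (hE : AI (ind E)) : AI (ind Eᶜ) := by
  intro h
  refine Set.Finite.subset (hE h) ?_
  intro g
  simp only [Function.mem_support]
  contrapose!
  rintro h1
  by_cases a : g ∈ E  <;> by_cases c : g * h ∈ E <;> simp_all [ind]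

lemma AI.inter {E H : Set (FG k)} (hE : AI (ind E)) (hH : AI (ind H)) : AI (ind (E ∩ H)) := by
  have := (hE.compl.union hH.compl).compl
  simpa [Set.compl_union] using this

lemma dd_compl (E : Set (FG k)) (h) : dd (ind Eᶜ) h = dd (ind E) h := by
  unfold dd
  refine finsum_congr fun g => ?_
  by_cases a : g ∈ E  <;> by_cases c : g * h ∈ E <;> simp_all [ind]

lemma cc_compl (E : Set (FG k)) (h) : cc (ind Eᶜ) h = - cc (ind E) h := by
  unfold cc
  rw [← finsum_neg_distrib]
  refine finsum_congr fun g => ?_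
  by_cases a : g ∈ E  <;> by_cases c : g * h ∈ E <;> simp_all [ind]

lemma cc_union_inter {E H : Set (FG k)} (hE : AI (ind E)) (hH : AI (ind H)) (h) :
    cc (ind (E ∪ H)) h + cc (ind (E ∩ H)) h = cc (ind E) h + cc (ind H) h := by
  rw [← cc_add (hE.union hH) (hE.inter hH), ind_union_inter, cc_add hE hH]

lemma dd_union_inter {E H : Set (FG k)} (hE : AI (ind E)) (hH : AI (ind H)) (h) :
    dd (ind (E ∪ H)) h + dd (ind (E ∩ H)) h ≤ dd (ind E) h + dd (ind H) h := by
  unfold dd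
  rw [← finsum_add_distrib (hfs_abs (hE h)) (hfs_abs (hH h)),
    ← finsum_add_distrib (hfs_abs ((hE.union hH) h)) (hfs_abs ((hE.inter hH) h))]
  refine finsum_le_finsum' ((hfs_abs ((hE.union hH) h)).add (hfs_abs ((hE.inter hH) h)))
    ((hfs_abs (hE h)).add (hfs_abs (hH h))) ?_
  intro g
  by_cases a : g ∈ E <;> by_cases b : g ∈ H <;> by_cases c : g * h ∈ E <;> by_cases d : g * h ∈ H <;>
    simp_all [ind]

lemma ind_diff_fin {E E' : Set (FG k)} {T : Set (FG k)} (hT : T.Finite)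
    (h : ∀ g ∉ T, (g ∈ E ↔ g ∈ E')) : HasFiniteSupport (ind E' - ind E) := by
  refine hT.subset ?_
  intro g
  simp only [Function.mem_support]
  contrapose!
  intro hg
  have := h g hg
  by_cases a : g ∈ E <;> simp_all [ind]

lemma AI.congr_fin {E E' : Set (FG k)} {T : Set (FG k)} (hT : T.Finite)
    (h : ∀ g ∉ T, (g ∈ E ↔ g ∈ E')) (hE : AI (ind E)) : AI (ind E') := by
  have := hE.add (AI.fin (ind_diff_fin hT h))
  simpa using this

lemma cc_congr_fin {E E' : Set (FG k)} {T : Set (FG k)} (hT : T.Finite)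
    (h : ∀ g ∉ T, (g ∈ E ↔ g ∈ E')) (hE : AI (ind E)) (x) : cc (ind E') x = cc (ind E) x := by
  have := cc_add hE (AI.fin (ind_diff_fin hT h)) x
  rw [cc_fin (ind_diff_fin hT h)] at this
  simpa using this

end AIsec
section Stars
open Function
variable {k : ℕ}

/-- letter as group element -/
def lt (x : Letter k) : FG k := FreeGroup.mk [x]

@[simp] lemma linv_linv (x : Letter k) : linv (linv x) = x := by simp [linv]
lemma linv_ne (x : Letter k) : linv x ≠ x := by
  intro h; have := congrArg Prod.snd h; simp [linv] at this
lemma linv_inj {x y : Letter k} (h : linv x = linv y) : x = y := by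
  rw [← linv_linv x, h, linv_linv]
lemma lt_linv (x : Letter k) : lt (linv x) = (lt x)⁻¹ := by
  simp [lt, FreeGroup.inv_mk, FreeGroup.invRev, linv]
lemma lt_true (i : Fin k) : lt (i, true) = FreeGroup.of i := rfl
lemma lt_false (i : Fin k) : lt (i, false) = (FreeGroup.of i)⁻¹ := by
  rw [← lt_true, ← lt_linv]; rfl
lemma toWord_lt (x : Letter k) : (lt x).toWord = [x] := by simp [lt]
lemma lt_inj {x y : Letter k} (h : lt x = lt y) : x = y := by
  have := congrArg FreeGroup.toWord h
  simpa [toWord_lt] using this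

lemma rel_iff (x y : Letter k) : (x.1 = y.1 → x.2 = y.2) ↔ x ≠ linv y := by
  obtain ⟨a, b⟩ := x; obtain ⟨c, d⟩ := y
  simp only [linv, ne_eq, Prod.mk.injEq, not_and]
  cases b <;> cases d <;> simp

lemma toWord_mk_of_red {L : List (Letter k)} (h : FreeGroup.IsReduced L) :
    (FreeGroup.mk L).toWord = L := by
  rw [FreeGroup.toWord_mk, h.reduce_eq]

lemma mul_lt_cases (g : FG k) (x : Letter k) :
    (g.toWord = (g * lt x).toWord ++ [linv x]) ∨
    ((g * lt x).toWord = g.toWord ++ [x]) := by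
  rcases List.eq_nil_or_concat g.toWord with h | ⟨L, y, h⟩
  · right
    rw [FreeGroup.toWord_eq_nil_iff] at h
    simp [h, toWord_lt]
  · rw [List.concat_eq_append] at h
    have hr : FreeGroup.IsReduced (L ++ [y]) := h ▸ FreeGroup.isReduced_toWord
    by_cases hy : y = linv x
    · left
      subst hy
      have : g = FreeGroup.mk L * lt (linv x) := by
        rw [lt, FreeGroup.mul_mk, ← h, FreeGroup.mk_toWord]
      rw [h]; congr 1
      rw [this, lt_linv]; simp
      exact (FreeGroup.IsReduced.reduce_eq (hr.infix ⟨[], [linv x], by simp⟩)).symm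
    · right
      have h2 : FreeGroup.IsReduced (L ++ [y] ++ [x]) := by
        refine FreeGroup.IsReduced.append_overlap hr ?_ (by simp)
        simp [rel_iff, hy]
      rw [FreeGroup.toWord_mul, h, toWord_lt]
      exact h2.reduce_eq

/-- star set -/
def St (S : Set (Letter k)) : Set (FG k) := {g | ∃ s ∈ S, g.toWord.head? = some s}

lemma ind_St_mul (S : Set (Letter k)) (g : FG k) (x : Letter k) :
    ind (St S) (g * lt x) - ind (St S) g =
      ind {h | h = 1 ∧ x ∈ S} g - ind {h | h * lt x = 1 ∧ linv x ∈ S} g := by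
  rcases mul_lt_cases g x with h | h
  · have hg : g ≠ 1 := by
      rintro rfl; simp at h
    by_cases h1 : g * lt x = 1
    · have : ind (St S) (g * lt x) = 0 := ind_of_notMem (by simp [St, h1])
      rw [this]
      have h : g.toWord = [linv x] := by rw [h1] at h; simpa using h
      by_cases hS : linv x ∈ S
      · rw [ind_of_mem (show g ∈ St S from ⟨_, hS, by simp [h]⟩)]
        simp [ind, hg, h1, hS]
      · rw [ind_of_notMem (show g ∉ St S by
          rintro ⟨s, hs, h'⟩; rw [h] at h'; simp at h'; exact hS (h' ▸ hs))]
        simp [ind, hg, hS]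
    · have e : g ∈ St S ↔ g * lt x ∈ St S := by
        simp only [St, Set.mem_ofPred_eq]
        rw [h, List.head?_append_of_ne_nil]
        simpa using h1
      have : ind (St S) (g * lt x) = ind (St S) g := by
        by_cases a : g ∈ St S
        · rw [ind_of_mem a, ind_of_mem (e.1 a)]
        · rw [ind_of_notMem a, ind_of_notMem (fun b => a (e.2 b))]
      rw [this]
      simp [ind, hg, h1]
  · have hg : g * lt x ≠ 1 := by
      intro h'; rw [h'] at h; simp at h
    by_cases h1 : g = 1
    · subst h1
      have : ind (St S) 1 = 0 := ind_of_notMem (by simp [St])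
      rw [this]
      simp at h
      by_cases hS : x ∈ S
      · rw [ind_of_mem (show 1 * lt x ∈ St S from ⟨_, hS, by simp [h]⟩)]
        simp at hg
        simp [ind, hS, hg]
      · rw [ind_of_notMem (show 1 * lt x ∉ St S by
          rintro ⟨s, hs, h'⟩; rw [one_mul, h] at h'; simp at h'; exact hS (h' ▸ hs))]
        simp at hg
        simp [ind, hS, hg]
    · have e : g ∈ St S ↔ g * lt x ∈ St S := by
        simp only [St, Set.mem_ofPred_eq]
        rw [h, List.head?_append_of_ne_nil]
        simpa using h1
      have : ind (St S) (g * lt x) = ind (St S) g := by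
        by_cases a : g ∈ St S
        · rw [ind_of_mem a, ind_of_mem (e.1 a)]
        · rw [ind_of_notMem a, ind_of_notMem (fun b => a (e.2 b))]
      rw [this]
      simp [ind, hg, h1]

lemma hfs_ind {E : Set (FG k)} (h : E.Finite) : HasFiniteSupport (ind E) := by
  refine h.subset ?_
  intro g
  simp only [Function.mem_support]
  contrapose!
  intro hg; exact ind_of_notMem hg

lemma fin_a (P : Prop) : {h : FG k | h = 1 ∧ P}.Finite :=
  (Set.finite_singleton 1).subset (by rintro h ⟨h, -⟩; exact h)
lemma fin_b (x : FG k) (P : Prop) : {h : FG k | h * x = 1 ∧ P}.Finite :=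
  (Set.finite_singleton x⁻¹).subset (by rintro h ⟨h, -⟩; exact mul_eq_one_iff_eq_inv.1 h)

lemma AI_St (S : Set (Letter k)) : AI (ind (St S)) := by
  apply AI.gen
  intro i
  have : (fun g => ind (St S) (g * FreeGroup.of i) - ind (St S) g) =
      fun g => ind {h | h = 1 ∧ (i, true) ∈ S} g -
        ind {h | h * lt (i, true) = 1 ∧ linv (i, true) ∈ S} g := by
    funext g; rw [← lt_true, ind_St_mul]
  rw [this]
  exact (hfs_ind (fin_a _)).sub (hfs_ind (fin_b _ _))

open Classical in
noncomputable def sg (S : Set (Letter k)) (i : Fin k) : ℤ :=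
  (if (i, true) ∈ S then 1 else 0) - (if (i, false) ∈ S then 1 else 0)

lemma cc_St (S : Set (Letter k)) (i : Fin k) : cc (ind (St S)) (FreeGroup.of i) = sg S i := by
  unfold cc
  simp_rw [← lt_true, ind_St_mul]
  rw [finsum_sub_distrib (hfs_ind (fin_a _)) (hfs_ind (fin_b _ _))]
  rw [finsum_eq_single _ 1, finsum_eq_single _ (lt (i,true))⁻¹]
  · unfold sg
    congr 1
    · by_cases h : (i, true) ∈ S <;> simp [ind, h]
    · by_cases h : (i, false) ∈ S <;> simp [ind, h, linv]
  · intro g hg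
    refine ind_of_notMem ?_
    rintro ⟨h, -⟩
    exact hg (mul_eq_one_iff_eq_inv.1 h)
  · intro g hg
    refine ind_of_notMem ?_
    rintro ⟨h, -⟩
    exact hg h

/-- functions with same coboundary agree -/
lemma eq_of_cobd {f f' : FG k → ℤ} (h1 : f 1 = f' 1)
    (h : ∀ g i, f (g * FreeGroup.of i) - f g = f' (g * FreeGroup.of i) - f' g) : f = f' := by
  have : ∀ x g, f (g * x) - f g = f' (g * x) - f' g := by
    intro x
    induction x using FreeGroup.induction_on with
    | C1 => simp
    | of i => exact fun g => h g i
    | inv_of i ih =>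
      intro g
      have := ih (g * (FreeGroup.of i)⁻¹)
      simp at this
      linarith
    | mul x y hx hy =>
      intro g
      have := hx g
      have := hy (g * x)
      simp only [mul_assoc] at *
      linarith
  funext x
  have := this x 1
  simp at this
  linarith

/-- left translation pulled back -/
def pre (u : FG k) (E : Set (FG k)) : Set (FG k) := {g | u * g ∈ E}

lemma ind_pre (u : FG k) (E : Set (FG k)) : ind (pre u E) = fun g => ind E (u * g) := by
  funext g
  by_cases h : u * g ∈ E
  · rw [ind_of_mem h, ind_of_mem (show g ∈ pre u E from h)]
  · rw [ind_of_notMem h, ind_of_notMem (show g ∉ pre u E from h)]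

lemma ind_inj {E E' : Set (FG k)} (h : ind E = ind E') : E = E' := by
  ext g
  have := congrFun h g
  by_cases a : g ∈ E <;> by_cases b : g ∈ E' <;> simp_all [ind]

/-- pulled back by automorphism -/
def preA (β : MulAut (FG k)) (E : Set (FG k)) : Set (FG k) := {g | β g ∈ E}

lemma ind_preA (u : MulAut (FG k)) (E : Set (FG k)) : ind (preA u E) = fun g => ind E (u g) := by
  funext g
  by_cases h : u g ∈ E
  · rw [ind_of_mem h, ind_of_mem (show g ∈ preA u E from h)]
  · rw [ind_of_notMem h, ind_of_notMem (show g ∉ preA u E from h)]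

lemma ind_congr {E E' : Set (FG k)} {g g'} (h : g ∈ E ↔ g' ∈ E') : ind E g = ind E' g' := by
  by_cases a : g ∈ E
  · rw [ind_of_mem a, ind_of_mem (h.1 a)]
  · rw [ind_of_notMem a, ind_of_notMem (fun b => a (h.2 b))]

lemma St_linv (y : Letter k) : St {linv y} = pre (lt y) (St {y})ᶜ := by
  apply ind_inj
  rw [ind_pre]
  have hc : ∀ g, ind (St {y})ᶜ g = 1 - ind (St {y}) g := by
    intro g
    by_cases a : g ∈ St {y} <;> simp [ind, a]
  apply eq_of_cobd
  · rw [hc, ind_of_notMem, ind_of_mem]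
    · norm_num
    · simp [St, toWord_lt]
    · simp [St]
  · intro g i
    rw [hc, hc, ← mul_assoc, ← lt_true, ind_St_mul]
    have e : ∀ a b : ℤ, 1 - a - (1 - b) = - (a - b) := by intros; ring
    rw [e, ind_St_mul, neg_sub]
    congr 1
    · apply ind_congr
      simp only [Set.mem_ofPred_eq, Set.mem_singleton_iff]
      constructor
      · rintro ⟨rfl, h⟩; rw [h, lt_linv]; simp
      · rintro ⟨h, h'⟩
        have : (i, true) = linv y := by rw [← h', linv_linv]
        refine ⟨?_, this⟩
        rw [this, lt_linv] at h
        simpa using h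
    · apply ind_congr
      simp only [Set.mem_ofPred_eq, Set.mem_singleton_iff]
      constructor
      · rintro ⟨h, h'⟩
        have h' := linv_inj h'
        subst h'
        refine ⟨?_, rfl⟩
        exact mul_eq_one_iff_eq_inv'.1 h ▸ (by simp)
      · rintro ⟨h, rfl⟩
        refine ⟨?_, rfl⟩
        rw [mul_eq_one_iff_eq_inv'] at h ⊢
        rw [h]; simp

lemma St_union (S T : Set (Letter k)) : St (S ∪ T) = St S ∪ St T := by
  ext g; simp only [St, Set.mem_ofPred_eq, Set.mem_union]
  grind

end Stars
section Len
open Function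
variable {k : ℕ}

lemma dd_St_one (f : FG k → ℤ) : dd f 1 = 0 := by simp [dd]

/-- the half-space of basis element j -/
def Hf (j : Fin k) : Set (FG k) := St {(j, true)}

lemma dd_Hf_lt (j : Fin k) (x : Letter k) : dd (ind (Hf j)) (lt x) = if x.1 = j then 1 else 0 := by
  unfold dd Hf
  simp_rw [ind_St_mul]
  obtain ⟨i, b⟩ := x
  by_cases hij : i = j
  · subst hij
    cases b
    · rw [finsum_eq_single _ (lt (i, false))⁻¹]
      · simp [ind, linv]
      · intro g hg
        have : ¬ (g * lt (i, false) = 1) := fun h => hg (mul_eq_one_iff_eq_inv.1 h)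
        simp [ind, this]
    · rw [finsum_eq_single _ 1]
      · simp [ind, linv]
      · intro g hg
        simp [ind, linv, hg]
  · simp [ind, linv, hij]

lemma dd_Hf_cons (j : Fin k) (x : Letter k) (L : List (Letter k))
    (h : FreeGroup.IsReduced (x :: L)) :
    dd (ind (Hf j)) (lt x * FreeGroup.mk L) =
      dd (ind (Hf j)) (lt x) + dd (ind (Hf j)) (FreeGroup.mk L) := by
  have hA : AI (ind (Hf j)) := AI_St (k := k) {(j, true)}
  have hL : FreeGroup.IsReduced L := h.infix ⟨[x], [], by simp⟩
  have e : dd (ind (Hf j)) (FreeGroup.mk L) = ∑ᶠ g, |ind (Hf j) (g * lt x * FreeGroup.mk L) -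
      ind (Hf j) (g * lt x)| := by
    unfold dd
    rw [← finsum_comp_equiv (Equiv.mulRight (lt x))]
    simp
  have h1 := hfs_abs (hfs_shift (hA (FreeGroup.mk L)) (Equiv.mulRight (lt x)))
  simp at h1
  rw [e]
  unfold dd
  rw [← finsum_add_distrib (hfs_abs (hA (lt x))) h1]
  refine finsum_congr ?_
  intro g
  rw [← mul_assoc]
  have key := ind_St_mul {(j, true)} g x
  unfold Hf at *
  have w1 : (lt x * FreeGroup.mk L).toWord = x :: L := by
    rw [lt, FreeGroup.mul_mk]; exact toWord_mk_of_red h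
  have w2 : (FreeGroup.mk L).toWord = L := toWord_mk_of_red hL
  by_cases c1 : g = 1 ∧ x = (j, true)
  · obtain ⟨rfl, rfl⟩ := c1
    have a1 : ind (St {(j, true)}) (1 * lt (j, true) * FreeGroup.mk L) = 1 :=
      ind_of_mem ⟨_, rfl, by rw [one_mul, w1]; rfl⟩
    have a2 : ind (St {(j, true)}) (1 * lt (j, true)) = 1 :=
      ind_of_mem ⟨_, rfl, by rw [one_mul, toWord_lt]; rfl⟩
    rw [a1, a2]; simp
  · by_cases c2 : g * lt x = 1 ∧ linv x = (j, true)
    · obtain ⟨h1, h2⟩ := c2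
      rw [h1]
      have a1 : ind (St {(j, true)}) (1 * FreeGroup.mk L) = 0 := by
        refine ind_of_notMem ?_
        rintro ⟨s, hs, h'⟩
        rw [one_mul, w2] at h'
        cases L with
        | nil => simp at h'
        | cons y L =>
          simp at h' hs
          rw [FreeGroup.isReduced_cons_cons] at h
          have := (rel_iff x y).1 h.1
          apply this
          rw [h', hs, ← h2, linv_linv]
      have a2 : ind (St {(j, true)}) (1 : FG k) = 0 := by
        refine ind_of_notMem ?_
        simp [St]
      rw [a1, a2]; simp
    · have : ind (St {(j, true)}) (g * lt x) - ind (St {(j, true)}) g = 0 := by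
        rw [key, ind_of_notMem (by simpa using c1), ind_of_notMem (by simpa using c2)]; simp
      have : ind (St {(j, true)}) (g * lt x) = ind (St {(j, true)}) g := by linarith
      rw [this]; simp

lemma sum_dd_mk (L : List (Letter k)) (h : FreeGroup.IsReduced L) :
    ∑ j, dd (ind (Hf j)) (FreeGroup.mk L) = L.length := by
  induction L with
  | nil => simp [← FreeGroup.one_eq_mk, dd_St_one]
  | cons x L ih =>
    have hL : FreeGroup.IsReduced L := h.infix ⟨[x], [], by simp⟩
    have : FreeGroup.mk (x :: L) = lt x * FreeGroup.mk L := by simp [lt]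
    rw [this]
    simp_rw [dd_Hf_cons _ x L h, Finset.sum_add_distrib, ih hL, dd_Hf_lt]
    simp [add_comm]

lemma sum_dd (h : FG k) : ∑ j, dd (ind (Hf j)) h = wordLength h := by
  have := sum_dd_mk h.toWord FreeGroup.isReduced_toWord
  rwa [FreeGroup.mk_toWord] at this

end Len

section Cap
open Function Filter Topology
variable {k : ℕ}

noncomputable def cap (w : FG k) (E : Set (FG k)) : ℝ :=
  limUnder atTop fun n : ℕ => (dd (ind E) (w ^ n) : ℝ) / n

lemma cap_tendsto (w : FG k) {E : Set (FG k)} (hE : AI (ind E)) :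
    Tendsto (fun n : ℕ => (dd (ind E) (w ^ n) : ℝ) / n) atTop (𝓝 (cap w E)) := by
  have hs : Subadditive (fun n : ℕ => (dd (ind E) (w ^ n) : ℝ)) := by
    intro m n
    have := dd_mul_le hE (w ^ m) (w ^ n)
    rw [← pow_add] at this
    show (dd (ind E) (w ^ (m + n)) : ℝ) ≤ dd (ind E) (w ^ m) + dd (ind E) (w ^ n)
    exact_mod_cast this
  have := hs.tendsto_lim ⟨0, by
    rintro _ ⟨n, rfl⟩
    have := dd_nonneg (ind E) (w ^ n)
    positivity⟩
  exact tendsto_nhds_limUnder ⟨_, this⟩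

lemma cap_eq_of {w w' : FG k} {E E' : Set (FG k)}
    (h : ∀ n : ℕ, dd (ind E) (w ^ n) = dd (ind E') (w' ^ n)) : cap w E = cap w' E' := by
  unfold cap; simp_rw [h]

lemma cap_nonneg (w : FG k) {E : Set (FG k)} (hE : AI (ind E)) : 0 ≤ cap w E := by
  refine ge_of_tendsto' (cap_tendsto w hE) fun n => ?_
  have := dd_nonneg (ind E) (w ^ n)
  positivity

lemma cap_compl (w : FG k) (E : Set (FG k)) : cap w Eᶜ = cap w E :=
  cap_eq_of fun _ => dd_compl _ _

lemma cap_pre (w u : FG k) (E : Set (FG k)) : cap w (pre u E) = cap w E :=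
  cap_eq_of fun _ => by rw [ind_pre, dd_tr]

lemma cap_preA (w : FG k) (β : MulAut (FG k)) (E : Set (FG k)) :
    cap w (preA β E) = cap (β w) E :=
  cap_eq_of fun _ => by rw [ind_preA, dd_aut, map_pow]

lemma cap_submod (w : FG k) {E H : Set (FG k)} (hE : AI (ind E)) (hH : AI (ind H)) :
    cap w (E ∪ H) + cap w (E ∩ H) ≤ cap w E + cap w H := by
  refine le_of_tendsto_of_tendsto' ((cap_tendsto w (hE.union hH)).add (cap_tendsto w (hE.inter hH)))
    ((cap_tendsto w hE).add (cap_tendsto w hH)) fun n => ?_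
  rw [← add_div, ← add_div]
  refine div_le_div_of_nonneg_right ?_ (Nat.cast_nonneg n)
  exact_mod_cast dd_union_inter hE hH (w ^ n)

lemma cap_le_of {w w' : FG k} {E E' : Set (FG k)} (hE : AI (ind E)) (hE' : AI (ind E')) (C : ℤ)
    (h : ∀ n : ℕ, dd (ind E) (w ^ n) ≤ dd (ind E') (w' ^ n) + C) : cap w E ≤ cap w' E' := by
  have h0 : Tendsto (fun n : ℕ => (C : ℝ) / n) atTop (𝓝 0) :=
    tendsto_const_div_atTop_nhds_zero_nat _
  have := (cap_tendsto w' hE').add h0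
  rw [add_zero] at this
  refine le_of_tendsto_of_tendsto' (cap_tendsto w hE) this fun n => ?_
  rw [← add_div]
  gcongr
  exact_mod_cast h n

lemma cap_fin_le (w : FG k) {E E' T : Set (FG k)} (hE : AI (ind E)) (hT : T.Finite)
    (h : ∀ g ∉ T, (g ∈ E ↔ g ∈ E')) : cap w E' ≤ cap w E := by
  have hf := ind_diff_fin hT h
  refine cap_le_of (AI.congr_fin hT h hE) hE (2 * ∑ᶠ g, |(ind E' - ind E) g|) fun n => ?_
  have := dd_add_le hE (AI.fin hf) (w ^ n)
  simp only [add_sub_cancel] at this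
  linarith [dd_fin hf (w ^ n)]

lemma cap_fin (w : FG k) {E E' T : Set (FG k)} (hE : AI (ind E)) (hT : T.Finite)
    (h : ∀ g ∉ T, (g ∈ E ↔ g ∈ E')) : cap w E' = cap w E :=
  le_antisymm (cap_fin_le w hE hT h)
    (cap_fin_le w (AI.congr_fin hT h hE) hT fun g hg => (h g hg).symm)

noncomputable def len (w : FG k) : ℝ := ∑ j, cap w (Hf j)

lemma len_tendsto (w : FG k) :
    Tendsto (fun n : ℕ => (wordLength (w ^ n) : ℝ) / n) atTop (𝓝 (len w)) := by
  have := tendsto_finsetSum Finset.univ fun (j : Fin k) _ => cap_tendsto w (AI_St {(j, true)})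
  refine this.congr fun n => ?_
  rw [← Finset.sum_div]
  congr 1
  have := sum_dd (w ^ n)
  exact_mod_cast this

lemma len_le (w : FG k) : len w ≤ wordLength w := by
  refine le_of_tendsto (len_tendsto w) ?_
  filter_upwards [eventually_gt_atTop 0] with n hn
  rw [div_le_iff₀ (by exact_mod_cast hn)]
  have : ∀ n, wordLength (w ^ n) ≤ wordLength w * n := by
    intro n
    induction n with
    | zero => simp [wordLength]
    | succ n ih =>
      have := FreeGroup.norm_mul_le (w ^ n) w
      rw [pow_succ]
      have e : ∀ g : FG k, FreeGroup.norm g = wordLength g := fun _ => rfl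
      simp only [e] at this
      linarith
  exact_mod_cast this n

lemma cr_iff (L : List (Letter k)) : CyclicallyReducedWord L ↔ FreeGroup.IsCyclicallyReduced L := by
  unfold CyclicallyReducedWord
  rw [← FreeGroup.isReduced_iff_reduce_eq, FreeGroup.isCyclicallyReduced_iff]
  exact List.isChain_append.trans (by tauto)

lemma len_of_cr {w : FG k} (hw : IsCyclicallyReduced w) : len w = wordLength w := by
  refine tendsto_nhds_unique (len_tendsto w) ?_
  refine tendsto_const_nhds.congr' ?_
  filter_upwards [eventually_gt_atTop 0] with n hn
  have h := ((cr_iff _).1 hw).flatten_replicate n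
  have : wordLength (w ^ n) = n * wordLength w := by
    unfold wordLength
    rw [FreeGroup.toWord_pow, h.isReduced.reduce_eq]
    simp
  rw [this]
  push_cast
  field_simp

lemma cap_conj (w x : FG k) {E : Set (FG k)} (hE : AI (ind E)) : cap (x * w * x⁻¹) E = cap w E := by
  have key : ∀ w x : FG k, cap (x * w * x⁻¹) E ≤ cap w E := by
    intro w x
    refine cap_le_of hE hE (dd (ind E) x + dd (ind E) x⁻¹) fun n => ?_
    rw [conj_pow]
    have := dd_mul_le hE (x * w ^ n) x⁻¹
    have := dd_mul_le hE x (w ^ n)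
    linarith
  refine le_antisymm (key w x) ?_
  have := key (x * w * x⁻¹) x⁻¹
  simpa [mul_assoc] using this

lemma len_conj (w x : FG k) : len (x * w * x⁻¹) = len w :=
  Finset.sum_congr rfl fun _ _ => cap_conj w x (AI_St _)

lemma exists_cr (g : FG k) : ∃ x u : FG k, IsCyclicallyReduced u ∧ g = x * u * x⁻¹ := by
  have h := FreeGroup.reduceCyclically.isCyclicallyReduced (FreeGroup.isReduced_toWord (x := g))
  refine ⟨FreeGroup.mk (FreeGroup.reduceCyclically.conjugator g.toWord),
    FreeGroup.mk (FreeGroup.reduceCyclically g.toWord), ?_, ?_⟩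
  · unfold IsCyclicallyReduced
    rw [cr_iff, toWord_mk_of_red h.isReduced]
    exact h
  · rw [FreeGroup.inv_mk, FreeGroup.mul_mk, FreeGroup.mul_mk,
      FreeGroup.reduceCyclically.conj_conjugator_reduceCyclically, FreeGroup.mk_toWord]

lemma cyclicLength_eq (g : FG k) : (cyclicLength g : ℝ) = len g := by
  have hne : {n | ∃ x u : FG k, IsCyclicallyReduced u ∧ g = x * u * x⁻¹ ∧ wordLength u = n}.Nonempty := by
    obtain ⟨x, u, h1, h2⟩ := exists_cr g
    exact ⟨_, x, u, h1, h2, rfl⟩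
  obtain ⟨x, u, h1, h2, h3⟩ := Nat.sInf_mem hne
  unfold cyclicLength
  rw [← h3, h2, len_conj, len_of_cr h1]

end Cap
section Cone
open Function
variable {k : ℕ}

def cone (v : FG k) : Set (FG k) := {g | v.toWord <+: g.toWord}
def adm (v : FG k) (s : Letter k) : Prop := FreeGroup.IsReduced (v.toWord ++ [s])
def ConstOn (E : Set (FG k)) (v : FG k) : Prop := (∀ g ∈ cone v, g ∈ E) ∨ (∀ g ∈ cone v, g ∉ E)

lemma adm_word {v : FG k} {s : Letter k} (h : adm v s) : (v * lt s).toWord = v.toWord ++ [s] := by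
  rw [FreeGroup.toWord_mul, toWord_lt]; exact h.reduce_eq

lemma self_mem_cone (v : FG k) : v ∈ cone v := List.prefix_rfl

lemma cone_child {v : FG k} {s : Letter k} (h : adm v s) (g : FG k) :
    g ∈ cone (v * lt s) ↔ v⁻¹ * g ∈ St {s} := by
  constructor
  · rintro ⟨t, ht⟩
    rw [adm_word h, List.append_assoc] at ht
    have hr : FreeGroup.IsReduced ([s] ++ t) :=
      (ht ▸ FreeGroup.isReduced_toWord (x := g)).infix ⟨v.toWord, [], by simp⟩
    have : v⁻¹ * g = FreeGroup.mk ([s] ++ t) := by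
      rw [inv_mul_eq_iff_eq_mul]
      nth_rewrite 1 [← FreeGroup.mk_toWord (x := v)]
      rw [FreeGroup.mul_mk, ht, FreeGroup.mk_toWord]
    refine ⟨s, rfl, ?_⟩
    rw [this, toWord_mk_of_red hr]; rfl
  · rintro ⟨s', hs', h'⟩
    obtain rfl : s' = s := hs'
    obtain ⟨t, ht⟩ : ∃ t, (v⁻¹ * g).toWord = [s'] ++ t := by
      cases hh : (v⁻¹ * g).toWord with
      | nil => simp [hh] at h'
      | cons a t => simp [hh] at h'; exact ⟨t, by simp [h']⟩
    have hr : FreeGroup.IsReduced (v.toWord ++ [s'] ++ t) := by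
      refine FreeGroup.IsReduced.append_overlap h ?_ (by simp)
      rw [← ht]; exact FreeGroup.isReduced_toWord
    have : g = FreeGroup.mk (v.toWord ++ [s'] ++ t) := by
      have : v⁻¹ * g = FreeGroup.mk ([s'] ++ t) := by rw [← ht, FreeGroup.mk_toWord]
      rw [inv_mul_eq_iff_eq_mul] at this
      rw [this, List.append_assoc]
      nth_rewrite 1 [← FreeGroup.mk_toWord (x := v)]
      rw [FreeGroup.mul_mk]
    refine ⟨t, ?_⟩
    rw [adm_word h, this, toWord_mk_of_red hr]

lemma cone_split {v g : FG k} (h : g ∈ cone v) (hne : g ≠ v) :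
    ∃ s, adm v s ∧ g ∈ cone (v * lt s) := by
  obtain ⟨t, ht⟩ := h
  cases t with
  | nil => exact absurd (FreeGroup.toWord_injective (by simpa using ht.symm)) hne
  | cons s t =>
    have ha : adm v s := (ht ▸ FreeGroup.isReduced_toWord (x := g)).infix ⟨[], t, by simp⟩
    refine ⟨s, ha, t, ?_⟩
    rw [adm_word ha, ← ht]; simp

lemma cone_child_sub {v : FG k} {s : Letter k} (h : adm v s) {g} (hg : g ∈ cone (v * lt s)) :
    g ∈ cone v := by
  obtain ⟨t, ht⟩ := hg
  rw [adm_word h] at ht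
  exact ⟨[s] ++ t, by rw [← ht]; simp⟩

lemma cone_trans {u v g : FG k} (h : v ∈ cone u) (h' : g ∈ cone v) : g ∈ cone u :=
  List.IsPrefix.trans h h'

lemma cone_comparable {u v g : FG k} (h : g ∈ cone u) (h' : g ∈ cone v) :
    v ∈ cone u ∨ u ∈ cone v :=
  List.prefix_or_prefix_of_prefix h h'

lemma leaf {v : FG k} {E : Set (FG k)} (hc : ∀ s, adm v s → ConstOn E (v * lt s)) (g : FG k)
    (hg : g ≠ v) :
    (g ∈ pre v⁻¹ (St {s | adm v s ∧ ∀ g ∈ cone (v * lt s), g ∈ E})) ↔ g ∈ E ∩ cone v := by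
  constructor
  · rintro ⟨s, ⟨hs, hs'⟩, h⟩
    have : g ∈ cone (v * lt s) := (cone_child hs g).2 ⟨s, rfl, h⟩
    exact ⟨hs' _ this, cone_child_sub hs this⟩
  · rintro ⟨h1, h2⟩
    obtain ⟨s, hs, h3⟩ := cone_split h2 hg
    obtain ⟨s', hs', h'⟩ := (cone_child hs g).1 h3
    obtain rfl : s' = s := hs'
    refine ⟨s', ⟨hs, ?_⟩, h'⟩
    rcases hc s' hs with h | h
    · exact h
    · exact absurd h1 (h g h3)

lemma ConstOn.compl {E : Set (FG k)} {v} (h : ConstOn E v) : ConstOn Eᶜ v := by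
  rcases h with h | h
  · right; simpa using h
  · left; simpa using h

lemma adm_iff {v u : FG k} {y : Letter k} (h : v.toWord = u.toWord ++ [y]) (s : Letter k) :
    adm v s ↔ s ≠ linv y := by
  unfold adm
  rw [h]
  constructor
  · rintro hr rfl
    have := hr.infix (L₁ := [y, linv y]) ⟨u.toWord, [], by simp⟩
    rw [FreeGroup.isReduced_cons_cons, rel_iff] at this
    simp at this
  · intro hs
    refine FreeGroup.IsReduced.append_overlap (h ▸ FreeGroup.isReduced_toWord (x := v)) ?_ (by simp)
    simp only [List.cons_append, List.nil_append]
    rw [FreeGroup.isReduced_cons_cons, rel_iff]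
    refine ⟨?_, FreeGroup.IsReduced.singleton⟩
    intro h; apply hs; rw [h]; simp

lemma sg_ne {S : Set (Letter k)} {i : Fin k} (h : sg S i ≠ 0) :
    ((i, true) ∈ S ∧ (i, false) ∉ S) ∨ ((i, false) ∈ S ∧ (i, true) ∉ S) := by
  unfold sg at h
  by_cases a : (i, true) ∈ S <;> by_cases b : (i, false) ∈ S <;> simp_all

lemma sg_J {S : Set (Letter k)} {y : Letter k} (h : y ∈ S) (h' : linv y ∉ S) :
    sg S y.1 = sg {y} y.1 ∧ sg S y.1 ≠ 0 := by
  obtain ⟨j, b⟩ := y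
  cases b <;> simp_all [sg, linv]

lemma sg_I {S S' : Set (Letter k)} {y : Letter k} {j : Fin k} (hj : j ≠ y.1)
    (h1 : (j, true) ∈ S' ↔ (j, true) ∉ S) (h2 : (j, false) ∈ S' ↔ (j, false) ∉ S) :
    sg S' j = - sg S j ∧ sg {y} j = 0 := by
  have h3 : (j, true) ≠ y := fun h => hj (congrArg Prod.fst h)
  have h4 : (j, false) ≠ y := fun h => hj (congrArg Prod.fst h)
  unfold sg
  by_cases a : (j, true) ∈ S <;> by_cases b : (j, false) ∈ S <;> simp [a, b, h1, h2, h3, h4]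

lemma AI_cone_child {v : FG k} {s : Letter k} (h : adm v s) : AI (ind (cone (v * lt s))) := by
  have : cone (v * lt s) = pre v⁻¹ (St {s}) := by
    ext g; exact cone_child h g
  rw [this, ind_pre]
  exact (AI_St _).tr _

/-- the structural properties of the capacity functional -/
structure CapLike (cp : Set (FG k) → ℝ) : Prop where
  sub : ∀ E H : Set (FG k), AI (ind E) → AI (ind H) → cp (E ∪ H) + cp (E ∩ H) ≤ cp E + cp H
  compl : ∀ E : Set (FG k), cp Eᶜ = cp E
  tr : ∀ (u : FG k) (E : Set (FG k)), cp (pre u E) = cp E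
  fin : ∀ E E' T : Set (FG k), AI (ind E) → T.Finite → (∀ g ∉ T, (g ∈ E ↔ g ∈ E')) → cp E' = cp E
  star : ∀ (S : Set (Letter k)) (y : Letter k), y ∈ S → linv y ∉ S → cp (St {y}) ≤ cp (St S)

variable {cp : Set (FG k) → ℝ}

lemma CapLike.half (hc : CapLike cp) (y : Letter k) : cp (St {y}) = cp (Hf y.1) := by
  obtain ⟨i, b⟩ := y
  cases b
  · have := St_linv (k := k) (i, true)
    have e : linv (i, true) = (i, false) := rfl
    rw [e] at this
    rw [this, hc.tr, hc.compl]; rfl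
  · rfl

lemma CapLike.star' (hc : CapLike cp) {S : Set (Letter k)} {i : Fin k} (h : sg S i ≠ 0) :
    cp (Hf i) ≤ cp (St S) := by
  rcases sg_ne h with ⟨h1, h2⟩ | ⟨h1, h2⟩
  · exact hc.star S _ h1 h2
  · have := hc.star S _ h1 h2
    rwa [hc.half] at this

/-- inductive step, with `y ∈ S` -/
lemma CapLike.step (hc : CapLike cp) {v u : FG k} {y : Letter k} (hv : v.toWord = u.toWord ++ [y])
    {E : Set (FG k)} (hE : AI (ind E)) (hcon : ∀ s, adm v s → ConstOn E (v * lt s))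
    (hy : ∀ g ∈ cone (v * lt y), g ∈ E)
    (ih1 : ∀ i, cc (ind (E ∪ cone v)) (FreeGroup.of i) ≠ 0 → cp (Hf i) ≤ cp (E ∪ cone v))
    (ih2 : ∀ i, cc (ind (E \ cone v)) (FreeGroup.of i) ≠ 0 → cp (Hf i) ≤ cp (E \ cone v))
    (i : Fin k) (hi : cc (ind E) (FreeGroup.of i) ≠ 0) : cp (Hf i) ≤ cp E := by
  have hu : adm u y := by unfold adm; rw [← hv]; exact FreeGroup.isReduced_toWord
  have huv : u * lt y = v := FreeGroup.toWord_injective (by rw [adm_word hu, hv])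
  set H := cone v with hH
  have HA : AI (ind H) := by rw [hH, ← huv]; exact AI_cone_child hu
  have Hpre : H = pre u⁻¹ (St {y}) := by
    rw [hH, ← huv]; ext g; exact cone_child hu g
  have Hcp : cp H = cp (Hf y.1) := by rw [Hpre, hc.tr, hc.half]
  have Hcc : ∀ j, cc (ind H) (FreeGroup.of j) = sg {y} j := by
    intro j; rw [Hpre, ind_pre, cc_tr, cc_St]
  set S : Set (Letter k) := {s | adm v s ∧ ∀ g ∈ cone (v * lt s), g ∈ E} with hS
  set S' : Set (Letter k) := {s | adm v s ∧ ∀ g ∈ cone (v * lt s), g ∈ Eᶜ} with hS'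
  have l1 := leaf hcon
  have l2 := leaf (E := Eᶜ) (fun s hs => (hcon s hs).compl)
  have pA : ∀ S : Set (Letter k), AI (ind (pre v⁻¹ (St S))) := by
    intro S; rw [ind_pre]; exact (AI_St _).tr _
  have A1 : cp (E ∩ H) = cp (St S) := by
    rw [hc.fin _ _ {v} (pA S) (Set.finite_singleton v) (fun g hg => l1 g hg), hc.tr]
  have B1 : cp (Eᶜ ∩ H) = cp (St S') := by
    rw [hc.fin _ _ {v} (pA S') (Set.finite_singleton v) (fun g hg => l2 g hg), hc.tr]
  have A2 : ∀ j, cc (ind (E ∩ H)) (FreeGroup.of j) = sg S j := by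
    intro j
    rw [cc_congr_fin (Set.finite_singleton v) (fun g hg => l1 g hg) (pA S), ind_pre, cc_tr, cc_St]
  have yS : y ∈ S := ⟨(adm_iff hv y).2 (linv_ne y).symm, hy⟩
  have lyS : linv y ∉ S := fun h => (adm_iff hv _).1 h.1 rfl
  have lyS' : linv y ∉ S' := fun h => (adm_iff hv _).1 h.1 rfl
  have SS' : ∀ s, s ≠ linv y → (s ∈ S' ↔ s ∉ S) := by
    intro s hs
    have ha := (adm_iff hv s).2 hs
    constructor
    · rintro ⟨-, h1⟩ ⟨-, h2⟩
      exact h1 _ (self_mem_cone _) (h2 _ (self_mem_cone _))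
    · intro h
      refine ⟨ha, ?_⟩
      rcases hcon s ha with h' | h'
      · exact absurd ⟨ha, h'⟩ h
      · exact h'
  have sJ : sg S y.1 = sg {y} y.1 ∧ sg S y.1 ≠ 0 := sg_J yS lyS
  have sI : ∀ j, j ≠ y.1 → sg S' j = - sg S j ∧ sg {y} j = 0 := by
    intro j hj
    exact sg_I hj (SS' (j, true) (fun h => hj (congrArg Prod.fst h)))
      (SS' (j, false) (fun h => hj (congrArg Prod.fst h)))
  have sub1 := hc.sub E H hE HA
  have sub2 := hc.sub Eᶜ H hE.compl HA
  have eD : (Eᶜ ∪ H) = (E \ H)ᶜ := by ext g; simp only [Set.mem_union, Set.mem_compl_iff, Set.mem_sdiff]; tauto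
  rw [eD, hc.compl, hc.compl, B1] at sub2
  rw [A1] at sub1
  have m1 := fun j => cc_union_inter hE HA (FreeGroup.of j)
  have m2 := fun j => cc_union_inter hE.compl HA (FreeGroup.of j)
  have m3 := fun j => cc_union_inter hE HA.compl (FreeGroup.of j)
  have ccD : ∀ j, cc (ind (E \ H)) (FreeGroup.of j) = cc (ind E) (FreeGroup.of j) - sg S j := by
    intro j
    have hd : AI (ind (E \ H)) := by rw [Set.sdiff_eq]; exact hE.inter HA.compl
    have := cc_union_inter hd (hE.inter HA) (FreeGroup.of j)
    have e1 : (E \ H) ∪ (E ∩ H) = E := by simp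
    have e2 : (E \ H) ∩ (E ∩ H) = ∅ := by ext; simp; tauto
    rw [e1, e2, A2] at this
    have e0 : cc (ind (∅ : Set (FG k))) (FreeGroup.of j) = 0 := by simp [cc, ind]
    linarith
  have starJ := hc.star' sJ.2
  by_cases hiJ : i = y.1
  · subst hiJ
    have := ih1 y.1 (by
      have := m1 y.1
      rw [A2, Hcc, sJ.1] at this
      intro h; apply hi; linarith)
    linarith
  · obtain ⟨q1, q2⟩ := sI i hiJ
    by_cases c1 : cc (ind (E ∪ H)) (FreeGroup.of i) = 0
    · have hSi : sg S i ≠ 0 := by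
        have := m1 i
        rw [A2, Hcc, q2, c1] at this
        intro h; apply hi; linarith
      by_cases c2 : cc (ind E) (FreeGroup.of y.1) = 0
      · have := ih2 y.1 (by rw [ccD, c2]; simpa using sJ.2)
        have := hc.star' (S := S') (i := i) (by rw [q1]; simpa using hSi)
        linarith
      · have := ih1 y.1 (by
          have := m1 y.1
          rw [A2, Hcc, sJ.1] at this
          intro h; apply c2; linarith)
        have := hc.star' hSi
        linarith
    · have := ih1 i c1
      linarith

lemma CapLike.main (hc : CapLike cp) : ∀ n, ∀ K : Finset (FG k), K.card = n →
    (∀ v ∈ K, ∀ u, v ∈ cone u → u ∈ K) → ∀ E : Set (FG k), AI (ind E) →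
    (∀ v ∉ K, ConstOn E v) → ∀ i, cc (ind E) (FreeGroup.of i) ≠ 0 → cp (Hf i) ≤ cp E := by
  intro n
  induction n with
  | zero =>
    intro K hK _ E hE hcon i hi
    have h1 := hcon 1 (by simp [Finset.card_eq_zero.1 hK])
    exfalso; apply hi
    have hall : ∀ g : FG k, g ∈ cone 1 := fun g => by simp [cone]
    unfold cc
    rcases h1 with h | h
    · simp [ind_of_mem (h _ (hall _))]
    · simp [ind_of_notMem (h _ (hall _))]
  | succ n ih =>
    intro K hK hpc E hE hcon i hi
    have hne : K.Nonempty := by rw [← Finset.card_pos]; omega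
    obtain ⟨v, hvK, hmax⟩ := Finset.exists_max_image K wordLength hne
    have hch : ∀ s, adm v s → v * lt s ∉ K := by
      intro s hs h
      have := hmax _ h
      unfold wordLength at this
      rw [adm_word hs] at this
      simp at this
    have hcon' : ∀ s, adm v s → ConstOn E (v * lt s) := fun s hs => hcon _ (hch s hs)
    rcases List.eq_nil_or_concat v.toWord with h | ⟨L, y, h⟩
    · rw [FreeGroup.toWord_eq_nil_iff] at h
      subst h
      have l1 := leaf hcon'
      have hall : ∀ g : FG k, g ∈ cone 1 := fun g => by simp [cone]
      have pA : ∀ S : Set (Letter k), AI (ind (pre 1⁻¹ (St S))) := by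
        intro S; rw [ind_pre]; exact (AI_St _).tr _
      have hh : ∀ g ∉ ({1} : Set (FG k)), _ :=
        fun g hg => (l1 g hg).trans (and_iff_left (hall g))
      rw [hc.fin _ _ {1} (pA _) (Set.finite_singleton 1) hh, hc.tr]
      rw [cc_congr_fin (Set.finite_singleton 1) hh (pA _), ind_pre, cc_tr, cc_St] at hi
      exact hc.star' hi
    · have hr : FreeGroup.IsReduced (L ++ [y]) := by
        rw [← List.concat_eq_append, ← h]; exact FreeGroup.isReduced_toWord
      have hv : v.toWord = (FreeGroup.mk L).toWord ++ [y] := by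
        rw [toWord_mk_of_red (hr.infix ⟨[], [y], by simp⟩), h, List.concat_eq_append]
      have HA : AI (ind (cone v)) := by
        have hu : adm (FreeGroup.mk L) y := by
          unfold adm; rw [← hv]; exact FreeGroup.isReduced_toWord
        have huv : (FreeGroup.mk L) * lt y = v :=
          FreeGroup.toWord_injective (by rw [adm_word hu, hv])
        rw [← huv]; exact AI_cone_child hu
      classical
      have hcard : (K.erase v).card = n := by rw [Finset.card_erase_of_mem hvK]; omega
      have hpc' : ∀ v' ∈ K.erase v, ∀ u, v' ∈ cone u → u ∈ K.erase v := by
        intro v' hv' u hu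
        rw [Finset.mem_erase] at hv' ⊢
        refine ⟨?_, hpc _ hv'.2 _ hu⟩
        rintro rfl
        have h1 := hmax _ hv'.2
        exact hv'.1 (FreeGroup.toWord_injective (hu.eq_of_length_le h1).symm)
      have cU : ∀ E : Set (FG k), (∀ v ∉ K, ConstOn E v) → ∀ u ∉ K.erase v,
          ConstOn (E ∪ cone v) u := by
        intro E hcon u hu
        by_cases huv : u ∈ cone v
        · left; intro g hg; right; exact cone_trans huv hg
        · have huK : u ∉ K := by
            intro h; apply hu; rw [Finset.mem_erase]
            exact ⟨fun h' => huv (h' ▸ self_mem_cone _), h⟩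
          have hd : ∀ g ∈ cone u, g ∉ cone v := by
            intro g h1 h2
            rcases cone_comparable h1 h2 with h | h
            · exact huK (hpc _ hvK _ h)
            · exact huv h
          rcases hcon u huK with h | h
          · left; intro g hg; left; exact h g hg
          · right; rintro g hg (h' | h')
            · exact h g hg h'
            · exact hd g hg h'
      have eD : ∀ E : Set (FG k), E \ cone v = (Eᶜ ∪ cone v)ᶜ := by
        intro E; ext g
        simp only [Set.mem_union, Set.mem_compl_iff, Set.mem_sdiff]; tauto
      have main : ∀ E : Set (FG k), AI (ind E) → (∀ v ∉ K, ConstOn E v) →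
          (∀ g ∈ cone (v * lt y), g ∈ E) →
          ∀ i, cc (ind E) (FreeGroup.of i) ≠ 0 → cp (Hf i) ≤ cp E := by
        intro E hE hcon hy
        refine hc.step hv hE (fun s hs => hcon _ (hch s hs)) hy ?_ ?_
        · exact ih _ hcard hpc' _ (hE.union HA) (cU E hcon)
        · rw [eD]
          exact ih _ hcard hpc' _ (hE.compl.union HA).compl
            (fun u hu => (cU Eᶜ (fun v hv => (hcon v hv).compl) u hu).compl)
      have hay : adm v y := (adm_iff hv y).2 (linv_ne y).symm
      rcases hcon' y hay with h | h
      · exact main E hE hcon h i hi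
      · have := main Eᶜ hE.compl (fun v hv => (hcon v hv).compl) h i
          (by rw [cc_compl]; simpa using hi)
        rwa [hc.compl] at this

lemma exists_K {E : Set (FG k)} (hE : AI (ind E)) : ∃ K : Finset (FG k),
    (∀ v ∈ K, ∀ u, v ∈ cone u → u ∈ K) ∧ ∀ v ∉ K, ConstOn E v := by
  classical
  set Q : Set (FG k) := ⋃ x : Letter k, support fun g => ind E (g * lt x) - ind E g with hQ
  have hQf : Q.Finite := Set.finite_iUnion fun x => hE _
  set K : Set (FG k) := {v | ∃ q ∈ Q, q ∈ cone v} with hK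
  have hKf : K.Finite := by
    have : K ⊆ ⋃ q ∈ Q, FreeGroup.mk '' {L | L ∈ q.toWord.inits} := by
      rintro v ⟨q, hq, hv⟩
      simp only [Set.mem_iUnion]
      exact ⟨q, hq, v.toWord, (List.mem_inits _ _).2 hv, FreeGroup.mk_toWord⟩
    refine Set.Finite.subset (hQf.biUnion fun q _ => Set.Finite.image _ ?_) this
    exact List.finite_toSet _
  refine ⟨hKf.toFinset, ?_, ?_⟩
  · intro v hv u hu
    rw [Set.Finite.mem_toFinset] at *
    obtain ⟨q, hq, hqv⟩ := hv
    exact ⟨q, hq, cone_trans hu hqv⟩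
  · intro v hv
    rw [Set.Finite.mem_toFinset] at hv
    have key : ∀ (L : List (Letter k)) (g : FG k), g.toWord = v.toWord ++ L →
        ind E g = ind E v := by
      intro L
      induction L using List.reverseRecOn with
      | nil => intro g hg; have : g = v := FreeGroup.toWord_injective (by simpa using hg)
               rw [this]
      | append_singleton L x ih =>
        intro g hg
        have hr : FreeGroup.IsReduced (v.toWord ++ L) :=
          (hg ▸ FreeGroup.isReduced_toWord (x := g)).infix ⟨[], [x], by simp⟩
        have e := toWord_mk_of_red hr
        have hg' : g = FreeGroup.mk (v.toWord ++ L) * lt x := by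
          rw [lt, FreeGroup.mul_mk, List.append_assoc, ← hg, FreeGroup.mk_toWord]
        rw [← ih _ e, hg']
        by_contra hne
        apply hv
        refine ⟨FreeGroup.mk (v.toWord ++ L), ?_, ?_⟩
        · rw [hQ, Set.mem_iUnion]
          exact ⟨x, fun h => hne (by linarith)⟩
        · show _ <+: _
          rw [e]; exact List.prefix_append _ _
    by_cases hvE : v ∈ E
    · left
      rintro g ⟨L, hL⟩
      have := key L g hL.symm
      by_contra h
      rw [ind_of_mem hvE, ind_of_notMem h] at this
      simp at this
    · right
      rintro g ⟨L, hL⟩ h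
      have := key L g hL.symm
      rw [ind_of_notMem hvE, ind_of_mem h] at this
      simp at this

theorem CapLike.claim (hc : CapLike cp) {E : Set (FG k)} (hE : AI (ind E)) (i : Fin k)
    (hi : cc (ind E) (FreeGroup.of i) ≠ 0) : cp (Hf i) ≤ cp E := by
  obtain ⟨K, h1, h2⟩ := exists_K hE
  exact hc.main _ K rfl h1 E hE h2 i hi

/-- global inequality -/
theorem CapLike.global (hc : CapLike cp) (α : MulAut (FG k)) :
    ∑ j, cp (Hf j) ≤ ∑ j, cp (preA α (Hf j)) := by
  classical
  let M : MulAut (FG k) → Matrix (Fin k) (Fin k) ℤ :=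
    fun α j i => cc (ind (Hf j)) (α (FreeGroup.of i))
  let φ : Fin k → (FG k →* Multiplicative ℤ) := fun j =>
    { toFun := fun g => Multiplicative.ofAdd (cc (ind (Hf j)) g)
      map_one' := by simp [cc]
      map_mul' := fun x y => by
        show Multiplicative.ofAdd (cc (ind (Hf j)) (x*y)) = _
        rw [show cc (ind (Hf j)) (x*y) = _ from cc_mul (AI_St _) x y]; rfl }
  have hφ : ∀ j g, cc (ind (Hf j)) g = Multiplicative.toAdd (φ j g) := fun _ _ => rfl
  have hof : ∀ j i : Fin k, cc (ind (Hf j)) (FreeGroup.of i) = if j = i then 1 else 0 := by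
    intro j i
    rw [Hf, cc_St]
    simp [sg, eq_comm]
  have hexp : ∀ (α : MulAut (FG k)) (j : Fin k) (g : FG k),
      cc (ind (Hf j)) (α g) = ∑ l, M α j l * cc (ind (Hf l)) g := by
    intro α j g
    induction g using FreeGroup.induction_on with
    | C1 => simp [cc]
    | of i => simp [hof, M]
    | inv_of i ih =>
      have e : ∀ (j : Fin k) (g : FG k), cc (ind (Hf j)) g⁻¹ = - cc (ind (Hf j)) g := by
        intro j g; simp [hφ]
      rw [map_inv]
      simp_rw [e, ih]
      simp
    | mul x y hx hy =>
      have e : ∀ (j : Fin k) (g h : FG k), cc (ind (Hf j)) (g * h) =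
          cc (ind (Hf j)) g + cc (ind (Hf j)) h := by
        intro j g h; exact cc_mul (AI_St _) _ _
      rw [map_mul]
      simp_rw [e, hx, hy, mul_add, Finset.sum_add_distrib]
  have hinv : M α * M α⁻¹ = 1 := by
    ext j i
    rw [Matrix.mul_apply]
    have := hexp α j (α⁻¹ (FreeGroup.of i))
    rw [MulAut.apply_inv_self, hof] at this
    rw [Matrix.one_apply, this]
  have hdet : (M α).det ≠ 0 := by
    intro h
    have := congrArg Matrix.det hinv
    rw [Matrix.det_mul, h] at this
    simp at this
  rw [Matrix.det_apply] at hdet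
  obtain ⟨σ, -, hσ⟩ := Finset.exists_ne_zero_of_sum_ne_zero hdet
  have hσ' : ∏ i, M α (σ i) i ≠ 0 := by
    intro h; apply hσ; rw [h]; simp
  rw [Finset.prod_ne_zero_iff] at hσ'
  rw [← Equiv.sum_comp σ (fun j => cp (preA α (Hf j)))]
  refine Finset.sum_le_sum fun i _ => ?_
  refine hc.claim ?_ i ?_
  · rw [ind_preA]; exact (AI_St _).aut α
  · rw [ind_preA, cc_aut]; exact hσ' i (Finset.mem_univ _)

end Cone
section Wh
open Function
variable {k : ℕ}

open Classical in
noncomputable def pw (a : Letter k) (S : Set (Letter k)) (x : Letter k) : FG k :=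
  if x ∈ S then lt a else 1

noncomputable def whF (a : Letter k) (S : Set (Letter k)) : FG k →* FG k :=
  FreeGroup.lift fun i => if i = a.1 then FreeGroup.of i else
    pw a S (i, true) * FreeGroup.of i * (pw a S (i, false))⁻¹

noncomputable def whB (a : Letter k) (S : Set (Letter k)) : FG k →* FG k :=
  FreeGroup.lift fun i => if i = a.1 then FreeGroup.of i else
    (pw a S (i, true))⁻¹ * FreeGroup.of i * (pw a S (i, false))

lemma whF_of_ne (a : Letter k) (S : Set (Letter k)) {i : Fin k} (h : i ≠ a.1) :
    whF a S (FreeGroup.of i) = pw a S (i, true) * FreeGroup.of i * (pw a S (i, false))⁻¹ := by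
  simp [whF, h]
lemma whB_of_ne (a : Letter k) (S : Set (Letter k)) {i : Fin k} (h : i ≠ a.1) :
    whB a S (FreeGroup.of i) = (pw a S (i, true))⁻¹ * FreeGroup.of i * (pw a S (i, false)) := by
  simp [whB, h]
lemma whF_of_eq (a : Letter k) (S : Set (Letter k)) :
    whF a S (FreeGroup.of a.1) = FreeGroup.of a.1 := by
  simp [whF]
lemma whB_of_eq (a : Letter k) (S : Set (Letter k)) :
    whB a S (FreeGroup.of a.1) = FreeGroup.of a.1 := by
  simp [whB]
lemma whF_a (a : Letter k) (S : Set (Letter k)) : whF a S (lt a) = lt a := by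
  have := whF_of_eq a S
  obtain ⟨i, b⟩ := a
  cases b
  · rw [lt_false, map_inv, this]
  · exact this
lemma whB_a (a : Letter k) (S : Set (Letter k)) : whB a S (lt a) = lt a := by
  have := whB_of_eq a S
  obtain ⟨i, b⟩ := a
  cases b
  · rw [lt_false, map_inv, this]
  · exact this
lemma whF_pw (a : Letter k) (S : Set (Letter k)) (x) : whF a S (pw a S x) = pw a S x := by
  unfold pw; split_ifs
  · exact whF_a a S
  · simp
lemma whB_pw (a : Letter k) (S : Set (Letter k)) (x) : whB a S (pw a S x) = pw a S x := by
  unfold pw; split_ifs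
  · exact whB_a a S
  · simp

noncomputable def wh (a : Letter k) (S : Set (Letter k)) : MulAut (FG k) :=
  MonoidHom.toMulEquiv (whF a S) (whB a S)
    (by
      ext i
      by_cases h : i = a.1
      · subst h; simp [whF_of_eq, whB_of_eq]
      · simp only [MonoidHom.comp_apply, MonoidHom.id_apply, whF_of_ne a S h, map_mul, map_inv,
          whB_pw, whB_of_ne a S h]
        group)
    (by
      ext i
      by_cases h : i = a.1
      · subst h; simp [whF_of_eq, whB_of_eq]
      · simp only [MonoidHom.comp_apply, MonoidHom.id_apply, whF_of_ne a S h, map_mul, map_inv,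
          whF_pw, whB_of_ne a S h]
        group)

lemma wh_apply (a : Letter k) (S : Set (Letter k)) (g) : wh a S g = whF a S g := rfl

lemma wh_lt (a : Letter k) (S : Set (Letter k)) {x : Letter k} (h : x.1 ≠ a.1) :
    wh a S (lt x) = pw a S x * lt x * (pw a S (linv x))⁻¹ := by
  obtain ⟨i, b⟩ := x
  rw [wh_apply]
  cases b
  · rw [lt_false, map_inv, whF_of_ne a S h]
    simp only [linv, mul_inv_rev, inv_inv, Bool.not_false]
    group
  · exact whF_of_ne a S h

lemma mem_letterSet_lt {x : FG k} : x ∈ letterSet k ↔ ∃ y, x = lt y := by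
  constructor
  · rintro ⟨i, h | h⟩
    · exact ⟨(i, true), h⟩
    · exact ⟨(i, false), by rw [h, lt_false]⟩
  · rintro ⟨⟨i, b⟩, h⟩
    cases b
    · exact ⟨i, Or.inr (by rw [h, lt_false])⟩
    · exact ⟨i, Or.inl h⟩

lemma fst_eq {x a : Letter k} (h : x.1 = a.1) : x = a ∨ x = linv a := by
  obtain ⟨i, b⟩ := x; obtain ⟨j, c⟩ := a
  obtain rfl : i = j := h
  cases b <;> cases c <;> simp [linv]

lemma wh_isW (a : Letter k) (S : Set (Letter k)) : IsWhitehead2 (wh a S) := by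
  refine ⟨lt (linv a), mem_letterSet_lt.2 ⟨_, rfl⟩, ?_, ?_⟩
  · rw [lt_linv, map_inv, wh_apply, whF_a]
  · intro x hx
    obtain ⟨y, rfl⟩ := mem_letterSet_lt.1 hx
    by_cases h : y.1 = a.1
    · left
      rcases fst_eq h with rfl | rfl
      · exact whF_a _ _
      · rw [lt_linv, map_inv, wh_apply, whF_a]
    · rw [wh_lt a S h, lt_linv, inv_inv]
      unfold pw
      split_ifs <;> simp

lemma wh_not_inner (a : Letter k) (S : Set (Letter k)) {b c : Letter k} (hb : b ∈ S)
    (hba : b.1 ≠ a.1) (hc : c ∉ S) (hca : c.1 ≠ a.1) : ¬ IsInner (wh a S) := by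
  rintro ⟨g, hg⟩
  by_cases hx : ∃ x : Letter k, x.1 ≠ a.1 ∧ x ∈ S ∧ linv x ∉ S
  · obtain ⟨x, h1, h2, h3⟩ := hx
    let ψ : FG k →* Multiplicative ℤ :=
      FreeGroup.lift fun i => if i = a.1 then Multiplicative.ofAdd 1 else 1
    have e := wh_lt a S h1
    rw [hg, MulAut.conj_apply] at e
    have e2 := congrArg ψ e
    simp only [pw, h2, h3, if_true, if_false, map_mul, map_inv, map_one] at e2
    have e3 : ψ (lt a) = 1 := by
      rw [mul_comm (ψ g), mul_assoc, mul_inv_cancel, mul_one, inv_one, mul_one] at e2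
      exact (mul_eq_right.1 e2.symm)
    obtain ⟨i, b⟩ := a
    cases b
    · rw [lt_false, map_inv] at e3
      simp [ψ] at e3
    · rw [lt_true] at e3
      simp [ψ] at e3
  · push Not at hx
    have hb' := hx b hba hb
    have hc' : linv c ∉ S := fun h => by
      have := hx (linv c) hca h
      rw [linv_linv] at this
      exact hc this
    let ψ : FG k →* Equiv.Perm (Fin 3) :=
      FreeGroup.lift fun i => if i = a.1 then Equiv.swap 1 2 else Equiv.swap 0 1
    have q1 : ∀ x : Letter k, x.1 ≠ a.1 → ψ (lt x) = Equiv.swap 0 1 := by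
      rintro ⟨i, b⟩ h
      have h : i ≠ a.1 := h
      cases b
      · rw [lt_false]; simp [ψ, h]
      · rw [lt_true]; simp [ψ, h]
    have q2 : ψ (lt a) = Equiv.swap 1 2 := by
      obtain ⟨i, b⟩ := a
      cases b
      · rw [lt_false]; simp [ψ]
      · rw [lt_true]; simp [ψ]
    have e : wh a S (lt b * lt c) = lt a * lt b * (lt a)⁻¹ * lt c := by
      rw [map_mul, wh_lt a S hba, wh_lt a S hca]
      simp [pw, hb, hb', hc, hc']
    rw [hg, MulAut.conj_apply] at e
    have e2 := congrArg ψ e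
    simp only [map_mul, map_inv, q1 b hba, q1 c hca, q2, Equiv.swap_mul_self, mul_one,
      mul_inv_cancel, Equiv.swap_inv] at e2
    exact absurd e2 (by decide)

lemma ind_St_ne (y x : Letter k) (hx : x.1 ≠ y.1) (g : FG k) :
    ind (St {y}) (g * lt x) = ind (St {y}) g := by
  have := ind_St_mul {y} g x
  have h1 : g ∉ {h : FG k | h = 1 ∧ x ∈ ({y} : Set (Letter k))} := by
    rintro ⟨-, h⟩
    exact hx (congrArg Prod.fst (show x = y from h))
  have h2 : g ∉ {h : FG k | h * lt x = 1 ∧ linv x ∈ ({y} : Set (Letter k))} := by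
    rintro ⟨-, h⟩
    have h' : linv x = y := h
    exact hx (by rw [← h']; rfl)
  rw [ind_of_notMem h1, ind_of_notMem h2] at this
  linarith

lemma wh_St (a : Letter k) (S : Set (Letter k)) (ha : a ∈ S) (ha' : linv a ∉ S) :
    preA (wh a S) (St {a}) = St S := by
  apply ind_inj
  rw [ind_preA]
  have p1 : ∀ (g : FG k) x, ind (St {a}) (g * pw a S x) - ind (St {a}) g =
      ind {h : FG k | h = 1 ∧ x ∈ S} g := by
    intro g x
    unfold pw
    split_ifs with h
    · rw [ind_St_mul]
      rw [ind_of_notMem (g := g) (E := {h | h * lt a = 1 ∧ linv a ∈ ({a} : Set (Letter k))}) (by simp [linv_ne])]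
      rw [sub_zero]
      exact ind_congr (by simp [h])
    · rw [ind_of_notMem (g := g) (E := {h | h = 1 ∧ x ∈ S}) (by simp [h])]; simp
  have p2 : ∀ (g : FG k) x, x.1 ≠ a.1 → ind (St {a}) (g * lt x) = ind (St {a}) g := by
    intro g x hx
    exact ind_St_ne a x hx g
  apply eq_of_cobd
  · simp [ind, St]
  · intro g i
    have hone : ∀ g, wh a S g = 1 ↔ g = 1 := fun g => by simp
    rw [← lt_true, ind_St_mul]
    by_cases h : i = a.1
    · have e : wh a S (lt (i, true)) = lt (i, true) := by
        subst h; exact whF_of_eq a S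
      rw [map_mul, e, ind_St_mul]
      have hm : ∀ x : Letter k, x.1 = a.1 → (x ∈ ({a} : Set (Letter k)) ↔ x ∈ S) := by
        intro x hx
        rcases fst_eq hx with rfl | rfl
        · simp [ha]
        · simp [ha', linv_ne]
      congr 1
      · apply ind_congr
        simp only [Set.mem_ofPred_eq, hone]
        rw [hm _ h]
      · apply ind_congr
        simp only [Set.mem_ofPred_eq]
        rw [hm _ h]
        nth_rewrite 1 [← e]
        rw [← map_mul, hone]
    · have e : wh a S (g * lt (i, true)) * pw a S (linv (i, true)) =
          wh a S g * pw a S (i, true) * lt (i, true) := by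
        rw [map_mul, wh_lt a S (x := (i, true)) h]; group
      have r1 := p1 (wh a S g) (i, true)
      have r2 := p2 (wh a S g * pw a S (i, true)) (i, true) h
      have r3 := p1 (wh a S (g * lt (i, true))) (linv (i, true))
      rw [e, r2] at r3
      have r4 : ind {h : FG k | h = 1 ∧ (i, true) ∈ S} (wh a S g) = ind {h : FG k | h = 1 ∧ (i, true) ∈ S} g :=
        ind_congr (by simp only [Set.mem_ofPred_eq, hone])
      have r5 : ind {h : FG k | h = 1 ∧ linv (i, true) ∈ S} (wh a S (g * lt (i, true))) =
        ind {h : FG k | h * lt (i, true) = 1 ∧ linv (i, true) ∈ S} g :=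
        ind_congr (by simp only [Set.mem_ofPred_eq, hone])
      linarith

lemma wh_Hf (a : Letter k) (S : Set (Letter k)) {j : Fin k} (hj : j ≠ a.1) :
    preA (wh a S) (Hf j) = pre (pw a S (j, true)) (Hf j) := by
  apply ind_inj
  rw [ind_preA, ind_pre]
  have p0 : ∀ (g : FG k) x, x.1 ≠ j → ind (Hf j) (g * lt x) = ind (Hf j) g := by
    intro g x hx
    exact ind_St_ne (j, true) x hx g
  have p1 : ∀ (g : FG k) x, ind (Hf j) (g * pw a S x) = ind (Hf j) g := by
    intro g x
    unfold pw
    split_ifs with h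
    · exact p0 g a hj.symm
    · simp
  have p3 : ∀ g : FG k, ind (Hf j) (g * lt (j, true)) - ind (Hf j) g = ind {1} g := by
    intro g
    have := ind_St_mul {(j, true)} g (j, true)
    rw [ind_of_notMem (E := {h | h * lt (j, true) = 1 ∧ linv (j, true) ∈ ({(j, true)} : Set (Letter k))})] at this
    · unfold Hf; rw [this, sub_zero]; exact ind_congr (by simp)
    · simp [linv_ne]
  apply eq_of_cobd
  · have := p1 1 (j, true)
    rw [one_mul] at this
    simp [this]
  · intro g i
    rw [← lt_true]
    by_cases h : i = a.1
    · have e : wh a S (lt (i, true)) = lt (i, true) := by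
        subst h; exact whF_of_eq a S
      have hij : i ≠ j := fun h' => hj (h' ▸ h)
      rw [map_mul, e, ← mul_assoc, p0 _ (i, true) hij, p0 _ (i, true) hij]; simp
    · have e : wh a S (g * lt (i, true)) * pw a S (linv (i, true)) =
          wh a S g * pw a S (i, true) * lt (i, true) := by
        rw [map_mul, wh_lt a S (x := (i, true)) h]; group
      have r1 := p1 (wh a S g) (i, true)
      have r3 := p1 (wh a S (g * lt (i, true))) (linv (i, true))
      rw [e] at r3
      rw [← r3, ← r1, ← mul_assoc]
      by_cases hij : i = j
      · subst hij
        rw [p3, p3]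
        apply ind_congr
        simp only [Set.mem_singleton_iff]
        have e5 : wh a S (pw a S (i, true)) = pw a S (i, true) := whF_pw _ _ _
        have e6 : wh a S g * pw a S (i, true) = wh a S (g * pw a S (i, true)) := by
          rw [map_mul, e5]
        rw [e6, EmbeddingLike.map_eq_one_iff, mul_eq_one_comm]
      · rw [p0 _ (i, true) hij, p0 _ (i, true) hij]; simp

lemma cap_half (w : FG k) (y : Letter k) : cap w (St {y}) = cap w (Hf y.1) := by
  obtain ⟨i, b⟩ := y
  cases b
  · have := St_linv (k := k) (i, true)
    have e : linv (i, true) = (i, false) := rfl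
    rw [e] at this
    rw [this, cap_pre, cap_compl]; rfl
  · rfl

lemma len_wh (a : Letter k) (S : Set (Letter k)) (ha : a ∈ S) (ha' : linv a ∉ S) (h : FG k) :
    len (wh a S h) + cap h (St {a}) = len h + cap h (St S) := by
  classical
  have e1 : ∀ j, j ≠ a.1 → cap (wh a S h) (Hf j) = cap h (Hf j) := by
    intro j hj
    rw [← cap_preA, wh_Hf a S hj, cap_pre]
  have e2 : cap (wh a S h) (Hf a.1) = cap h (St S) := by
    rw [← cap_half, ← cap_preA, wh_St a S ha ha']
  unfold len
  rw [← Finset.add_sum_erase _ _ (Finset.mem_univ a.1), ← Finset.add_sum_erase _ _ (Finset.mem_univ a.1),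
    e2, cap_half]
  rw [Finset.sum_congr rfl fun j hj => e1 j (Finset.ne_of_mem_erase hj)]
  ring

lemma cap_triv (ν : FG k) (a : Letter k) (S : Set (Letter k)) (ha : a ∈ S) (ha' : linv a ∉ S)
    (h : (∀ b ∈ S, b.1 = a.1) ∨ (∀ c ∉ S, c.1 = a.1)) : cap ν (St S) = cap ν (St {a}) := by
  rcases h with h | h
  · have : S = {a} := by
      ext x
      constructor
      · intro hx
        rcases fst_eq (h x hx) with rfl | rfl
        · rfl
        · exact absurd hx ha'
      · rintro rfl; exact ha
    rw [this]
  · have : S = {linv a}ᶜ := by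
      ext x
      constructor
      · rintro hx rfl
        exact ha' hx
      · intro hx
        by_contra hn
        rcases fst_eq (h x hn) with rfl | rfl
        · exact hn ha
        · exact hx rfl
    have e : cap ν (St S) = cap ν (St {linv a})ᶜ := by
      refine cap_fin ν (AI_St _).compl (Set.finite_singleton 1) ?_
      intro g hg
      rw [this]
      simp only [St, Set.mem_compl_iff, Set.mem_ofPred_eq, Set.mem_singleton_iff]
      have : g.toWord ≠ [] := fun h => hg (FreeGroup.toWord_eq_nil_iff.1 h)
      cases hh : g.toWord with
      | nil => exact absurd hh this
      | cons a t => simp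
    rw [e, cap_compl, cap_half, cap_half]; rfl

end Wh
section SMcap
open Filter
variable {k : ℕ}

lemma sm_star {w : FG k} (hw : w ∈ SM k) (S : Set (Letter k)) (y : Letter k) (hy : y ∈ S)
    (hy' : linv y ∉ S) :
    (∀ ν : FG k, cap ν (St S) = cap ν (St {y})) ∨ cap w (St {y}) < cap w (St S) := by
  by_cases h : (∀ b ∈ S, b.1 = y.1) ∨ (∀ c ∉ S, c.1 = y.1)
  · left; intro ν; exact cap_triv ν y S hy hy' h
  · right
    push Not at h
    obtain ⟨⟨b, hb, hb'⟩, ⟨c, hc, hc'⟩⟩ := h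
    have h1 := hw.2 (wh y S) (wh_isW y S) (wh_not_inner y S hb hb' hc hc')
    have h2 := len_wh y S hy hy' w
    rw [← cyclicLength_eq, len_of_cr hw.1] at h2
    have h3 : (wordLength w : ℝ) < cyclicLength (wh y S w) := by exact_mod_cast h1
    linarith

lemma sm_N {w : FG k} (hw : w ∈ SM k) (ν : FG k) : ∃ N : ℝ, 0 ≤ N ∧
    CapLike fun E => N * cap w E + cap ν E := by
  have : ∀ p : Set (Letter k) × Letter k, ∀ᶠ N : ℝ in atTop, p.2 ∈ p.1 → linv p.2 ∉ p.1 →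
      N * cap w (St {p.2}) + cap ν (St {p.2}) ≤ N * cap w (St p.1) + cap ν (St p.1) := by
    rintro ⟨S, y⟩
    by_cases h1 : y ∈ S
    · by_cases h2 : linv y ∉ S
      · rcases sm_star hw S y h1 h2 with h | h
        · filter_upwards with N _ _
          simp only [h]; rfl
        · filter_upwards [eventually_ge_atTop
            ((cap ν (St {y}) - cap ν (St S)) / (cap w (St S) - cap w (St {y})))] with N hN _ _
          rw [div_le_iff₀ (by linarith)] at hN
          show _ ≤ _
          linarith
      · filter_upwards with N _ h; exact absurd h h2
    · filter_upwards with N h; exact absurd h h1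
  obtain ⟨N, h0, hN⟩ := ((eventually_ge_atTop (0 : ℝ)).and (eventually_all.2 this)).exists
  refine ⟨N, h0, ?_, ?_, ?_, ?_, ?_⟩
  · intro E H hE hH
    have h1 := mul_le_mul_of_nonneg_left (cap_submod w hE hH) h0
    have h2 := cap_submod ν hE hH
    show _ ≤ _
    linarith
  · intro E; simp only [cap_compl]
  · intro u E; simp only [cap_pre]
  · intro E E' T hE hT h
    simp only [cap_fin w hE hT h, cap_fin ν hE hT h]
  · intro S y h1 h2
    exact hN (S, y) h1 h2

lemma sm_global {w : FG k} (hw : w ∈ SM k) (ν : FG k) : ∃ N : ℝ, 0 ≤ N ∧ ∀ α : MulAut (FG k),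
    N * len w + len ν ≤ N * len (α w) + len (α ν) := by
  obtain ⟨N, h0, hN⟩ := sm_N hw ν
  refine ⟨N, h0, fun α => ?_⟩
  have := hN.global α
  simp only [cap_preA, Finset.sum_add_distrib, ← Finset.mul_sum] at this
  exact this

lemma sm_min {w : FG k} (hw : w ∈ SM k) (α : MulAut (FG k)) : len w ≤ len (α w) := by
  obtain ⟨N, h0, h⟩ := sm_global hw w
  have := h α
  nlinarith

end SMcap
section Words
variable {k : ℕ}

lemma wl_mk_le (L : List (Letter k)) : wordLength (FreeGroup.mk L) ≤ L.length :=
  FreeGroup.norm_mk_le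

lemma wl_mul_le (x y : FG k) : wordLength (x * y) ≤ wordLength x + wordLength y :=
  FreeGroup.norm_mul_le x y

lemma red_append {L M : List (Letter k)} (hL : FreeGroup.IsReduced L) (hM : FreeGroup.IsReduced M)
    (h : ∀ x ∈ L.getLast?, ∀ y ∈ M.head?, x ≠ linv y) : FreeGroup.IsReduced (L ++ M) := by
  unfold FreeGroup.IsReduced at *
  rw [List.isChain_append]
  refine ⟨hL, hM, fun x hx y hy => ?_⟩
  exact (rel_iff x y).2 (h x hx y hy)

lemma cr_word {g : FG k} : IsCyclicallyReduced g ↔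
    ∀ x ∈ g.toWord.getLast?, ∀ y ∈ g.toWord.head?, x ≠ linv y := by
  unfold IsCyclicallyReduced
  rw [cr_iff, FreeGroup.isCyclicallyReduced_iff]
  simp only [FreeGroup.isReduced_toWord, true_and, rel_iff]

lemma not_cr {g : FG k} (h : ¬ IsCyclicallyReduced g) : ∃ x M, g.toWord = x :: (M ++ [linv x]) := by
  rw [cr_word] at h
  push Not at h
  obtain ⟨x, hx, y, hy, h⟩ := h
  cases hh : g.toWord with
  | nil => simp [hh] at hx
  | cons z t =>
    rw [hh] at hx hy
    obtain rfl : z = y := by simpa using hy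
    rcases List.eq_nil_or_concat t with rfl | ⟨M, l, rfl⟩
    · obtain rfl : z = x := by simpa using hx
      exact absurd h.symm (linv_ne z)
    · rw [List.concat_eq_append] at *
      rw [← List.cons_append, List.getLast?_concat] at hx
      obtain rfl : l = x := by simpa using hx
      exact ⟨z, M, by rw [h]⟩

lemma conj_word (x : Letter k) (M : List (Letter k)) :
    FreeGroup.mk (x :: (M ++ [linv x])) = lt x * FreeGroup.mk M * (lt x)⁻¹ := by
  rw [← lt_linv]
  simp [lt]

lemma cr_iff_len {g : FG k} : IsCyclicallyReduced g ↔ (wordLength g : ℝ) ≤ len g := by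
  constructor
  · intro h; rw [len_of_cr h]
  · intro h
    by_contra hn
    obtain ⟨x, M, hM⟩ := not_cr hn
    have e : g = lt x * FreeGroup.mk M * (lt x)⁻¹ := by
      rw [← conj_word, ← hM, FreeGroup.mk_toWord]
    have h1 : len g ≤ M.length := by
      rw [e, len_conj]
      refine (len_le _).trans ?_
      exact_mod_cast wl_mk_le M
    have h2 : wordLength g = M.length + 2 := by unfold wordLength; rw [hM]; simp
    rw [h2] at h
    push_cast at h
    linarith

lemma word_of_len {L : List (Letter k)} (h : L.length ≤ wordLength (FreeGroup.mk L)) :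
    (FreeGroup.mk L).toWord = L := by
  have : (FreeGroup.reduce L).Sublist L := FreeGroup.reduce.red.sublist
  rw [FreeGroup.toWord_mk]
  refine this.eq_of_length_le ?_
  rw [← FreeGroup.toWord_mk]
  exact h

/-- an element conjugate to `u` represented by a word of length `|u|`, `u` cyc. reduced -/
lemma rot_word {u x : FG k} (hu : IsCyclicallyReduced u) {L : List (Letter k)}
    (hL : L.length = wordLength u) (h : FreeGroup.mk L = x * u * x⁻¹) :
    IsCyclicallyReduced (FreeGroup.mk L) ∧ (FreeGroup.mk L).toWord = L := by
  have h1 : len (FreeGroup.mk L) = L.length := by rw [h, len_conj, len_of_cr hu, hL]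
  have h2 := len_le (FreeGroup.mk L)
  rw [h1] at h2
  constructor
  · rw [cr_iff_len, h1]; exact_mod_cast wl_mk_le L
  · exact word_of_len (by exact_mod_cast h2)

lemma invRev_append (L M : List (Letter k)) :
    FreeGroup.invRev (L ++ M) = FreeGroup.invRev M ++ FreeGroup.invRev L := by
  simp [FreeGroup.invRev]

lemma conj_rot : ∀ (n : ℕ) (g u v : FG k), g.toWord.length = n → IsCyclicallyReduced u →
    IsCyclicallyReduced v → v = g * u * g⁻¹ → u.toWord ~r v.toWord := by
  intro n
  induction n with
  | zero =>
    intro g u v hg _ _ h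
    rw [List.length_eq_zero_iff, FreeGroup.toWord_eq_nil_iff] at hg
    subst hg
    rw [h]; simp
    rfl
  | succ n ih =>
    intro g u v hg hu hv h
    rcases List.eq_nil_or_concat g.toWord with hg' | ⟨G, x, hG⟩
    · simp [hg'] at hg
    rw [List.concat_eq_append] at hG
    have hr : FreeGroup.IsReduced (G ++ [x]) := by
      rw [← hG]; exact FreeGroup.isReduced_toWord
    have hrG : FreeGroup.IsReduced G := hr.infix ⟨[], [x], by simp⟩
    have hgx : g = FreeGroup.mk G * lt x := by
      rw [lt, FreeGroup.mul_mk, ← hG, FreeGroup.mk_toWord]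
    have hGn : (FreeGroup.mk G).toWord.length = n := by
      rw [toWord_mk_of_red hrG]; rw [hG] at hg; simpa using hg
    have red : ∀ L : List (Letter k), L.length = wordLength u →
        FreeGroup.mk L = lt x * u * (lt x)⁻¹ → u.toWord ~r L → u.toWord ~r v.toWord := by
      intro L h1 h2 h3
      obtain ⟨c1, c2⟩ := rot_word hu h1 h2
      have := ih (FreeGroup.mk G) (FreeGroup.mk L) v hGn c1 hv (by
        rw [h, hgx, h2]; group)
      rw [c2] at this
      exact h3.trans this
    have hU := FreeGroup.mk_toWord (x := u)
    by_cases hA : u.toWord.head? = some (linv x)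
    · obtain ⟨t, ht⟩ : ∃ t, u.toWord = linv x :: t := by
        cases hh : u.toWord with
        | nil => simp [hh] at hA
        | cons a t => simp [hh] at hA; exact ⟨t, by rw [hA]⟩
      refine red (t ++ [linv x]) ?_ ?_ ?_
      · unfold wordLength; rw [ht]; simp
      · rw [← hU, ht, ← lt_linv]
        rw [show linv x :: t = [linv x] ++ t from rfl]
        rw [← FreeGroup.mul_mk, ← FreeGroup.mul_mk, ← lt, lt_linv]; group
      · rw [ht]
        exact ⟨1, by simp⟩
    by_cases hB : u.toWord.getLast? = some x
    · obtain ⟨t, ht⟩ : ∃ t, u.toWord = t ++ [x] := by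
        rcases List.eq_nil_or_concat u.toWord with hh | ⟨t, l, hh⟩
        · simp [hh] at hB
        · rw [List.concat_eq_append] at hh
          rw [hh, List.getLast?_concat] at hB
          obtain rfl : l = x := by simpa using hB
          exact ⟨t, hh⟩
      refine red (x :: t) ?_ ?_ ?_
      · unfold wordLength; rw [ht]; simp
      · rw [← hU, ht]
        rw [show x :: t = [x] ++ t from rfl]
        rw [← FreeGroup.mul_mk, ← FreeGroup.mul_mk, ← lt]; group
      · rw [ht]
        refine List.IsRotated.symm ⟨1, by simp⟩
    by_cases hu1 : u = 1
    · subst hu1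
      have : v = 1 := by rw [h]; group
      rw [this]
    exfalso
    have hne : u.toWord ≠ [] := fun h => hu1 (FreeGroup.toWord_eq_nil_iff.1 h)
    have r1 : FreeGroup.IsReduced (g.toWord ++ u.toWord) := by
      refine red_append FreeGroup.isReduced_toWord FreeGroup.isReduced_toWord ?_
      rw [hG, List.getLast?_concat]
      intro a ha b hb hab
      obtain rfl : x = a := by simpa using ha
      apply hA
      rw [hab, linv_linv]; exact hb
    have r2 : FreeGroup.IsReduced (u.toWord ++ (g⁻¹).toWord) := by
      refine red_append FreeGroup.isReduced_toWord FreeGroup.isReduced_toWord ?_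
      rw [FreeGroup.toWord_inv, hG, invRev_append]
      intro a ha b hb hab
      have : linv x = b := by simpa [FreeGroup.invRev, linv] using hb
      apply hB
      rw [← this, linv_linv] at hab
      rw [← hab]; exact ha
    have r3 := FreeGroup.IsReduced.append_overlap r1 r2 hne
    have e : v = FreeGroup.mk (g.toWord ++ u.toWord ++ (g⁻¹).toWord) := by
      rw [← FreeGroup.mul_mk, ← FreeGroup.mul_mk, FreeGroup.mk_toWord, FreeGroup.mk_toWord,
        FreeGroup.mk_toWord, h]
    have e2 := congrArg List.length (toWord_mk_of_red r3)
    rw [← e] at e2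
    have e3 : (wordLength v : ℝ) = wordLength u := by
      rw [← len_of_cr hu, ← len_of_cr hv, h, len_conj]
    have e4 : wordLength v = wordLength u := by exact_mod_cast e3
    unfold wordLength at e4
    simp at e2
    have : 0 < g.toWord.length := by omega
    omega

lemma rot_conj (L : List (Letter k)) (n : ℕ) :
    ∃ x : FG k, FreeGroup.mk (L.rotate n) = x * FreeGroup.mk L * x⁻¹ := by
  induction n with
  | zero => exact ⟨1, by simp⟩
  | succ n ih =>
    obtain ⟨x, hx⟩ := ih
    rw [← List.rotate_rotate]
    cases hh : L.rotate n with
    | nil => exact ⟨x, by rw [← hx, hh]; simp⟩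
    | cons a t =>
      refine ⟨(lt a)⁻¹ * x, ?_⟩
      have : FreeGroup.mk (List.rotate (a :: t) 1) = (lt a)⁻¹ * FreeGroup.mk (a :: t) * lt a := by
        rw [show a :: t = [a] ++ t from rfl, ← FreeGroup.mul_mk, ← lt]
        simp only [List.singleton_append, List.rotate_cons_succ, List.rotate_zero]
        rw [← FreeGroup.mul_mk, ← lt]; group
      rw [this, ← hh, hx]; group

lemma letters_of_contract {γ : MulAut (FG k)} (hγ : ∀ u, len (γ u) ≤ len u) :
    ∃ g : FG k, ∀ i, ∃ y, g⁻¹ * γ (FreeGroup.of i) * g = lt y := by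
  let F : FG k → ℕ := fun g => ∑ i, wordLength (g⁻¹ * γ (FreeGroup.of i) * g)
  obtain ⟨g, hg⟩ : ∃ g, ∀ g', F g ≤ F g' := by
    obtain ⟨g, hg⟩ := exists_minimalFor_of_wellFoundedLT (fun _ : FG k => True) F ⟨1, trivial⟩
    refine ⟨g, fun g' => ?_⟩
    by_contra hlt
    push Not at hlt
    exact absurd (hg.2 trivial hlt.le) (by omega)
  refine ⟨g, ?_⟩
  by_contra hcon
  push Not at hcon
  obtain ⟨i, hi⟩ := hcon
  let H : Fin k → FG k := fun j => g⁻¹ * γ (FreeGroup.of j) * g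
  have Hne : ∀ j, H j ≠ 1 := by
    intro j hj
    have : γ (FreeGroup.of j) = 1 := by
      have : g * H j * g⁻¹ = 1 := by rw [hj]; group
      simpa [H, mul_assoc] using this
    simp at this
  have lenof : ∀ j, len (FreeGroup.of j : FG k) ≤ 1 := fun j => by
    refine (len_le _).trans ?_
    simp [wordLength]
  have c1 : ∀ u, len (g⁻¹ * γ u * g) ≤ len u := by
    intro u
    have := len_conj (γ u) g⁻¹
    rw [inv_inv] at this
    rw [this]; exact hγ u
  have H1 : ∀ j, len (H j) ≤ 1 := fun j => (c1 _).trans (lenof j)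
  have H2 : ∀ j, len (H i * H j) ≤ 2 := by
    intro j
    have e : H i * H j = g⁻¹ * γ (FreeGroup.of i * FreeGroup.of j) * g := by
      simp only [H, map_mul]; group
    rw [e]
    refine (c1 _).trans ((len_le _).trans ?_)
    have : wordLength (FreeGroup.of i * FreeGroup.of j : FG k) ≤ 2 := by
      refine (wl_mul_le _ _).trans ?_
      simp [wordLength]
    exact_mod_cast this
  have hpos : ∀ j, (H j).toWord ≠ [] := fun j h => Hne j (FreeGroup.toWord_eq_nil_iff.1 h)
  have hi2 : 2 ≤ wordLength (H i) := by
    cases hh : (H i).toWord with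
    | nil => exact absurd hh (hpos i)
    | cons a t =>
      cases t with
      | nil =>
        exfalso; apply hi a
        exact FreeGroup.toWord_injective (by rw [toWord_lt]; exact hh)
      | cons b t => unfold wordLength; rw [hh]; simp
  have hncr : ¬ IsCyclicallyReduced (H i) := by
    intro h
    have := len_of_cr h
    have h1 := H1 i
    rw [this] at h1
    have : wordLength (H i) ≤ 1 := by exact_mod_cast h1
    omega
  obtain ⟨x, M, hM⟩ := not_cr hncr
  have hconj : ∀ j, (g * lt x)⁻¹ * γ (FreeGroup.of j) * (g * lt x) = (lt x)⁻¹ * H j * lt x := by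
    intro j; simp only [H]; group
  have hlt : F (g * lt x) < F g := by
    refine Finset.sum_lt_sum (fun j _ => ?_) ⟨i, Finset.mem_univ _, ?_⟩
    · rw [hconj]
      show _ ≤ wordLength (H j)
      have hU := FreeGroup.mk_toWord (x := H j)
      by_cases hA : (H j).toWord.head? = some x
      · obtain ⟨t, ht⟩ : ∃ t, (H j).toWord = x :: t := by
          cases hh : (H j).toWord with
          | nil => simp [hh] at hA
          | cons a t => simp [hh] at hA; exact ⟨t, by rw [hA]⟩
        have e : (lt x)⁻¹ * H j * lt x = FreeGroup.mk (t ++ [x]) := by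
          rw [← hU, ht, show x :: t = [x] ++ t from rfl, ← FreeGroup.mul_mk, ← FreeGroup.mul_mk,
            ← lt]; group
        rw [e]
        refine (wl_mk_le _).trans ?_
        unfold wordLength; rw [ht]; simp
      by_cases hB : (H j).toWord.getLast? = some (linv x)
      · obtain ⟨t, ht⟩ : ∃ t, (H j).toWord = t ++ [linv x] := by
          rcases List.eq_nil_or_concat (H j).toWord with hh | ⟨t, l, hh⟩
          · simp [hh] at hB
          · rw [List.concat_eq_append] at hh
            rw [hh, List.getLast?_concat] at hB
            obtain rfl : l = linv x := by simpa using hB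
            exact ⟨t, hh⟩
        have e : (lt x)⁻¹ * H j * lt x = FreeGroup.mk (linv x :: t) := by
          rw [← hU, ht, show linv x :: t = [linv x] ++ t from rfl, ← FreeGroup.mul_mk,
            ← FreeGroup.mul_mk, ← lt, lt_linv]; group
        rw [e]
        refine (wl_mk_le _).trans ?_
        unfold wordLength; rw [ht]; simp
      exfalso
      have hM' : (H i).toWord = (x :: M) ++ [linv x] := hM
      have r : FreeGroup.IsReduced ((H i).toWord ++ (H j).toWord) := by
        refine red_append FreeGroup.isReduced_toWord FreeGroup.isReduced_toWord ?_
        rw [hM', List.getLast?_concat]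
        intro a ha b hb hab
        obtain rfl : linv x = a := by simpa using ha
        apply hA
        rw [linv_inj hab]; exact hb
      have e : (H i * H j).toWord = (H i).toWord ++ (H j).toWord := by
        rw [FreeGroup.toWord_mul, r.reduce_eq]
      have hcr : IsCyclicallyReduced (H i * H j) := by
        rw [cr_word, e]
        intro a ha b hb hab
        rw [List.getLast?_append_of_ne_nil _ (hpos j)] at ha
        rw [hM] at hb
        obtain rfl : x = b := by simpa using hb
        apply hB
        rw [← hab]; exact ha
      have h2 := H2 j
      rw [len_of_cr hcr] at h2
      have h3 : wordLength (H i * H j) ≤ 2 := by exact_mod_cast h2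
      have h4 : wordLength (H i * H j) = wordLength (H i) + (H j).toWord.length := by
        unfold wordLength; rw [e]; simp
      have h5 : 0 < (H j).toWord.length := List.length_pos_iff.2 (hpos j)
      omega
    · rw [hconj]
      show _ < wordLength (H i)
      have e : (lt x)⁻¹ * H i * lt x = FreeGroup.mk M := by
        rw [← FreeGroup.mk_toWord (x := H i), hM, conj_word]; group
      rw [e]
      refine (wl_mk_le _).trans_lt ?_
      unfold wordLength; rw [hM]; simp
  exact absurd (hg (g * lt x)) (by omega)

lemma letterSet_finite : (letterSet k).Finite := by
  have : letterSet k = Set.range (lt (k := k)) := by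
    ext x; rw [mem_letterSet_lt, Set.mem_range]
    exact exists_congr fun y => eq_comm
  rw [this]; exact Set.finite_range _

lemma relabel_of {τ : MulAut (FG k)} (h : ∀ i, ∃ y, τ (FreeGroup.of i) = lt y) :
    IsRelabeling τ := by
  refine Set.eq_of_subset_of_ncard_le ?_ ?_ letterSet_finite
  · rintro _ ⟨x, ⟨i, hx⟩, rfl⟩
    obtain ⟨y, hy⟩ := h i
    rw [mem_letterSet_lt]
    rcases hx with rfl | rfl
    · exact ⟨y, hy⟩
    · exact ⟨linv y, by rw [map_inv, hy, lt_linv]⟩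
  · rw [Set.ncard_image_of_injective _ τ.injective]

lemma relabel_inv {τ : MulAut (FG k)} (h : IsRelabeling τ) : IsRelabeling τ⁻¹ := by
  unfold IsRelabeling at *
  nth_rewrite 1 [← h]
  rw [← Set.image_comp]
  have : (⇑τ⁻¹ ∘ ⇑τ) = id := by funext x; simp
  rw [this, Set.image_id]

lemma relabel_wl {τ : MulAut (FG k)} (h : IsRelabeling τ) (w : FG k) :
    wordLength (τ w) ≤ wordLength w := by
  have key : ∀ L : List (Letter k), wordLength (τ (FreeGroup.mk L)) ≤ L.length := by
    intro L
    induction L with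
    | nil => 
      have : FreeGroup.mk ([] : List (Letter k)) = 1 := rfl
      rw [this, map_one]; simp [wordLength]
    | cons a t ih =>
      rw [show a :: t = [a] ++ t from rfl, ← FreeGroup.mul_mk, ← lt, map_mul]
      refine (wl_mul_le _ _).trans ?_
      have : τ (lt a) ∈ letterSet k := h ▸ ⟨lt a, mem_letterSet_lt.2 ⟨a, rfl⟩, rfl⟩
      obtain ⟨y, hy⟩ := mem_letterSet_lt.1 this
      rw [hy]
      have : wordLength (lt y) = 1 := by unfold wordLength; rw [toWord_lt]; rfl
      rw [this]; simp; omega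
  have := key w.toWord
  rwa [FreeGroup.mk_toWord] at this

end Words
/-- every `w ∈ SM` is minimal in its `Aut(F_k)`-orbit; moreover a
cyclically reduced `v` of the same length lies in the orbit of `w` iff some relabeling
automorphism `τ` makes `τ w` a cyclic permutation of `v`. -/
theorem SM_minimal_and_orbit (k : ℕ) (hk : 2 ≤ k) (w : FG k) (hw : w ∈ SM k) :
    (∀ α : MulAut (FG k), wordLength w ≤ wordLength (α w)) ∧
    (∀ v : FG k, IsCyclicallyReduced v → wordLength v = wordLength w →
      ((∃ α : MulAut (FG k), α w = v) ↔
        ∃ τ : MulAut (FG k), IsRelabeling τ ∧ IsCyclicPerm (τ w) v)) := by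
  have key : ∀ α : MulAut (FG k), wordLength w ≤ wordLength (α w) := by
    intro α
    have h1 := sm_min hw α
    rw [len_of_cr hw.1] at h1
    exact_mod_cast h1.trans (len_le _)
  refine ⟨key, fun v hv hvw => ⟨?_, ?_⟩⟩
  · rintro ⟨α, rfl⟩
    have hlen : len (α w) = len w := by rw [len_of_cr hv, len_of_cr hw.1, hvw]
    have hexp : ∀ u, len (α⁻¹ u) ≤ len u := by
      intro u
      obtain ⟨N, -, hN⟩ := sm_global hw (α⁻¹ u)
      have := hN α
      rw [hlen, MulAut.apply_inv_self] at this
      linarith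
    obtain ⟨g, hg⟩ := letters_of_contract hexp
    have hr : IsRelabeling (MulAut.conj g⁻¹ * α⁻¹) := by
      apply relabel_of
      intro i
      obtain ⟨y, hy⟩ := hg i
      exact ⟨y, by rw [← hy]; simp⟩
    have hr' := relabel_inv hr
    refine ⟨_, hr', ?_⟩
    have e : (MulAut.conj g⁻¹ * α⁻¹)⁻¹ w = α g * α w * (α g)⁻¹ := by
      rw [mul_inv_rev, inv_inv, MulAut.mul_apply, ← map_inv, inv_inv, MulAut.conj_apply]
      simp
    have hcr : IsCyclicallyReduced ((MulAut.conj g⁻¹ * α⁻¹)⁻¹ w) := by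
      rw [cr_iff_len]
      have h1 := relabel_wl hr' w
      rw [e, len_conj, hlen, len_of_cr hw.1, ← e]
      exact_mod_cast h1
    obtain ⟨n, hn⟩ := conj_rot _ (α g) _ _ rfl hv hcr e
    exact ⟨n, hn.symm⟩
  · rintro ⟨τ, -, n, hn⟩
    obtain ⟨x, hx⟩ := rot_conj v.toWord n
    rw [← hn, FreeGroup.mk_toWord, FreeGroup.mk_toWord] at hx
    refine ⟨MulAut.conj x⁻¹ * τ, ?_⟩
    rw [MulAut.mul_apply, hx, MulAut.conj_apply]
    group
end
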